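/- Let s = 1 and R = R_1. For t ∈ ℕ write t = 11ℓ + r with 0 ≤ r ≤ 10. Then: (a) dim_K HH^t(R) = 7 if t = 0; (b) dim_K HH^t(R) = 2 if either r ∈ {0,6}, t > 0, ℓ even, char K = 3, or r ∈ {4,10}, ℓ odd, char K = 3; (c) dim_K HH^t(R) = 1 if one of the following holds: r ∈ {0,6}, t > 0, ℓ even, char K ≠ 3; r ∈ {1,9}; r ∈ {2,3}, ℓ odd; r ∈ {3,4}, ℓ even, char K = 2; r ∈ {4,10}, ℓ odd, char K ≠ 3; r = 5, char K = 3; r ∈ {6,7}, ℓ odd, char K = 2; r ∈ {7,8}, ℓ even; (d) in all other cases dim_K HH^t(R) = 0. -/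

import Mathlib

open scoped TensorProduct

set_option synthInstance.maxHeartbeats 1000000
set_option maxHeartbeats 2000000

universe u v

namespace E6

/-- Generators of the presentation of the path algebra of the quiver `𝒬ₛ`:
trivial paths `e i`, arrows `a i` (the `αᵢ`), `b i` (the `βᵢ`) and `g i` (the `γᵢ`). -/
inductive Gen (s : ℕ) : Type
  | e (i : ZMod (6 * s))
  | a (i : ZMod (3 * s))
  | b (i : ZMod (3 * s))
  | g (i : ZMod s)

variable (K : Type u) [Field K] (s : ℕ)

/-- The free algebra on the generators. -/
abbrev F : Type u := FreeAlgebra K (Gen s)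

/-- Trivial path generators. -/
noncomputable def E (i : ZMod (6 * s)) : F K s := FreeAlgebra.ι K (Gen.e i)
/-- `α` arrow generators. -/
noncomputable def A (i : ZMod (3 * s)) : F K s := FreeAlgebra.ι K (Gen.a i)
/-- `β` arrow generators. -/
noncomputable def B (i : ZMod (3 * s)) : F K s := FreeAlgebra.ι K (Gen.b i)
/-- `γ` arrow generators. -/
noncomputable def G (i : ZMod s) : F K s := FreeAlgebra.ι K (Gen.g i)

/-- Source vertex of the arrow `αᵢ` : writing `i = 3t + j` with `j < 3`,
`α_{3t} : 6t → 6t+1`, `α_{3t+1} : 6t+1 → 6t+2`, `α_{3t+2} : 6t+2 → 6t+5`. -/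
def aSrc (i : ZMod (3 * s)) : ZMod (6 * s) := ((2 * i.val - i.val % 3 : ℕ) : ZMod (6 * s))

/-- Target vertex of the arrow `αᵢ`. -/
def aTgt (i : ZMod (3 * s)) : ZMod (6 * s) :=
  if i.val % 3 = 1 then ((2 * i.val : ℕ) : ZMod (6 * s)) else ((2 * i.val + 1 : ℕ) : ZMod (6 * s))

/-- Source vertex of the arrow `βᵢ` : `β_{3t} : 6t → 6t+3`, `β_{3t+1} : 6t+3 → 6t+4`,
`β_{3t+2} : 6t+4 → 6t+5`. -/
def bSrc (i : ZMod (3 * s)) : ZMod (6 * s) :=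
  if i.val % 3 = 1 then ((2 * i.val + 1 : ℕ) : ZMod (6 * s)) else ((2 * i.val : ℕ) : ZMod (6 * s))

/-- Target vertex of the arrow `βᵢ`. -/
def bTgt (i : ZMod (3 * s)) : ZMod (6 * s) := ((2 * i.val + 3 - i.val % 3 : ℕ) : ZMod (6 * s))

/-- Source vertex of the arrow `γₜ : 6t+5 → 6t+6`. -/
def gSrc (i : ZMod s) : ZMod (6 * s) := ((6 * i.val + 5 : ℕ) : ZMod (6 * s))

/-- Target vertex of the arrow `γₜ`. -/
def gTgt (i : ZMod s) : ZMod (6 * s) := ((6 * i.val + 6 : ℕ) : ZMod (6 * s))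

/-- The set of arrow generators inside the free algebra. -/
noncomputable def arrows : Set (F K s) :=
  Set.range (A K s) ∪ Set.range (B K s) ∪ Set.range (G K s)

/-- The relations presenting `R_s = K[𝒬ₛ]/I₀` as a quotient of the free algebra on the
trivial paths and the arrows.  The first eight families of relations present the path
algebra `K[𝒬ₛ]` (the trivial paths are orthogonal idempotents summing to `1`, and each
arrow is fixed by multiplication with the trivial paths at its target, resp. source);
the remaining relations generate the ideal `I₀`: all paths of length `5` vanish
(equivalently, all products of five arrows), `α_{3t+2}α_{3t+1}α_{3t} = β_{3t+2}β_{3t+1}β_{3t}`,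
and `α_{3t+3}γ_tβ_{3t+2} = 0 = β_{3t+3}γ_tα_{3t+2}`. -/
inductive Rel : F K s → F K s → Prop
  | idem (i j : ZMod (6 * s)) :
      Rel (E K s i * E K s j) (if i = j then E K s i else 0)
  | sum_one :
      Rel (∑ i ∈ Finset.range (6 * s), E K s (i : ZMod (6 * s))) 1
  | a_tgt (i : ZMod (3 * s)) : Rel (E K s (aTgt s i) * A K s i) (A K s i)
  | a_src (i : ZMod (3 * s)) : Rel (A K s i * E K s (aSrc s i)) (A K s i)
  | b_tgt (i : ZMod (3 * s)) : Rel (E K s (bTgt s i) * B K s i) (B K s i)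
  | b_src (i : ZMod (3 * s)) : Rel (B K s i * E K s (bSrc s i)) (B K s i)
  | g_tgt (i : ZMod s) : Rel (E K s (gTgt s i) * G K s i) (G K s i)
  | g_src (i : ZMod s) : Rel (G K s i * E K s (gSrc s i)) (G K s i)
  | len5 (x₁ x₂ x₃ x₄ x₅ : F K s) (h₁ : x₁ ∈ arrows K s) (h₂ : x₂ ∈ arrows K s)
      (h₃ : x₃ ∈ arrows K s) (h₄ : x₄ ∈ arrows K s) (h₅ : x₅ ∈ arrows K s) :
      Rel (x₁ * x₂ * x₃ * x₄ * x₅) 0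
  | comm (t : Fin s) :
      Rel (A K s ((3 * (t : ℕ) + 2 : ℕ) : ZMod (3 * s)) *
             A K s ((3 * (t : ℕ) + 1 : ℕ) : ZMod (3 * s)) *
             A K s ((3 * (t : ℕ) : ℕ) : ZMod (3 * s)))
          (B K s ((3 * (t : ℕ) + 2 : ℕ) : ZMod (3 * s)) *
             B K s ((3 * (t : ℕ) + 1 : ℕ) : ZMod (3 * s)) *
             B K s ((3 * (t : ℕ) : ℕ) : ZMod (3 * s)))
  | zero_agb (t : Fin s) :
      Rel (A K s ((3 * (t : ℕ) + 3 : ℕ) : ZMod (3 * s)) * G K s (((t : ℕ) : ℕ) : ZMod s) *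
             B K s ((3 * (t : ℕ) + 2 : ℕ) : ZMod (3 * s))) 0
  | zero_bga (t : Fin s) :
      Rel (B K s ((3 * (t : ℕ) + 3 : ℕ) : ZMod (3 * s)) * G K s (((t : ℕ) : ℕ) : ZMod s) *
             A K s ((3 * (t : ℕ) + 2 : ℕ) : ZMod (3 * s))) 0

/-- The self-injective algebra `R_s` of tree class `E₆`, i.e. the quotient
`K[𝒬ₛ]/I₀` of the path algebra of `𝒬ₛ`, presented by generators and relations. -/
abbrev Alg : Type u := RingQuot (Rel K s)

/-- A canonical `Semiring` instance on `R_s`, routed through the `Ring` structure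
(this keeps instance paths on `R_s` coherent). -/
noncomputable instance (priority := 1100) : Semiring (Alg K s) :=
  Ring.toSemiring

/-- The images `e_i` in `R_s` of the trivial paths. -/
noncomputable def ee (i : ZMod (6 * s)) : Alg K s :=
  RingQuot.mkAlgHom K (Rel K s) (E K s i)

/-- The images `α_i` in `R_s` of the arrows `α`. -/
noncomputable def aa (i : ZMod (3 * s)) : Alg K s :=
  RingQuot.mkAlgHom K (Rel K s) (A K s i)

/-- The images `β_i` in `R_s` of the arrows `β`. -/
noncomputable def bb (i : ZMod (3 * s)) : Alg K s :=
  RingQuot.mkAlgHom K (Rel K s) (B K s i)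

/-- The images `γ_i` in `R_s` of the arrows `γ`. -/
noncomputable def gg (i : ZMod s) : Alg K s :=
  RingQuot.mkAlgHom K (Rel K s) (G K s i)

/-! ### The enveloping algebra `Λ = R ⊗ₖ Rᵐᵒᵖ` and the outer bimodule structure on `R` -/

/-- The enveloping algebra `Λ = R_s ⊗[K] R_sᵐᵒᵖ`. -/
abbrev Env : Type u := Alg K s ⊗[K] (Alg K s)ᵐᵒᵖ

/-- A canonical `Semiring` instance on `Λ`, routed through the `Ring` structure
(this keeps instance paths on `Λ` coherent). -/
noncomputable instance (priority := 1100) : Semiring (Env K s) :=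
  Ring.toSemiring

/-- `R_s` is a left `Λ`-module via the outer action `(a ⊗ b) • r = a * r * b.unop`. -/
noncomputable instance : Module (Env K s) (Alg K s) :=
  TensorProduct.Algebra.module


instance : SMulCommClass (Env K s) K (Alg K s) where
  smul_comm l k r := by
    induction l using TensorProduct.induction_on with
    | zero => simp
    | tmul a b =>
        show a • b • (k • r) = k • (a • b • r)
        rw [smul_comm b k r, smul_comm a k (b • r)]
    | add x y hx hy =>
        rw [add_smul, add_smul, smul_add, hx, hy]

instance : IsScalarTower K (Env K s) (Alg K s) where
  smul_assoc k l r := by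
    induction l using TensorProduct.induction_on with
    | zero => simp
    | tmul a b =>
        show ((k • a) ⊗ₜ[K] b) • r = k • (a ⊗ₜ[K] b) • r
        show (k • a) • b • r = k • (a • (b • r))
        rw [smul_assoc]
    | add x y hx hy =>
        rw [smul_add, add_smul, add_smul, hx, hy, smul_add]

/-! ### Projective and simple modules -/

/-- The quotient of a module by a submodule (as a type). -/
def modQuot {R : Type v} [Ring R] {M : Type*} [AddCommGroup M] [Module R M]
    (p : Submodule R M) : Type _ := M ⧸ p

noncomputable instance {R : Type v} [Ring R] {M : Type*} [AddCommGroup M] [Module R M]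
    (p : Submodule R M) : AddCommGroup (modQuot p) :=
  inferInstanceAs (AddCommGroup (M ⧸ p))

noncomputable instance {R : Type v} [Ring R] {M : Type*} [AddCommGroup M] [Module R M]
    (p : Submodule R M) : Module R (modQuot p) :=
  inferInstanceAs (Module R (M ⧸ p))

/-- Right multiplication by a fixed element, as an endomorphism of the left regular module. -/
def rmul (Λ : Type v) [Ring Λ] (x : Λ) : Λ →ₗ[Λ] Λ where
  toFun y := y * x
  map_add' a b := add_mul a b x
  map_smul' r a := mul_assoc r a x

/-- The Jacobson radical of the ring `Λ` times the `Λ`-module `M`, i.e. the submodule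
`rad(Λ)·M` generated by all products `r • x` with `r` in the Jacobson radical of `Λ`
(the Jacobson radical being the intersection of all maximal left ideals). -/
def radSMul (Λ : Type v) [Ring Λ] (M : Type w) [AddCommGroup M] [Module Λ M] :
    Submodule Λ M :=
  Submodule.span Λ {z | ∃ r ∈ (⊥ : Ideal Λ).jacobson, ∃ x : M, z = r • x}

/-- The indecomposable projective left `R_s`-module `P_i = R_s·e_i`. -/
noncomputable def P (i : ZMod (6 * s)) : Submodule (Alg K s) (Alg K s) :=
  LinearMap.range (rmul (Alg K s) (ee K s i))

/-- The simple left `R_s`-module `S_i = P_i / rad(P_i)` at the vertex `i`. -/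
noncomputable def S (i : ZMod (6 * s)) : Type u :=
  modQuot (radSMul (Alg K s) ↥(P K s i))

noncomputable instance (i : ZMod (6 * s)) : AddCommGroup (S K s i) :=
  inferInstanceAs (AddCommGroup (modQuot (radSMul (Alg K s) ↥(P K s i))))

noncomputable instance (i : ZMod (6 * s)) : Module (Alg K s) (S K s i) :=
  inferInstanceAs (Module (Alg K s) (modQuot (radSMul (Alg K s) ↥(P K s i))))

/-- The canonical projection `P_i → S_i`. -/
noncomputable def toS (i : ZMod (6 * s)) : ↥(P K s i) →ₗ[Alg K s] S K s i :=
  (radSMul (Alg K s) ↥(P K s i)).mkQ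

/-- Corestriction of right multiplication by `e_i` to `P_i`. -/
noncomputable def toP (i : ZMod (6 * s)) : Alg K s →ₗ[Alg K s] ↥(P K s i) :=
  LinearMap.codRestrict (P K s i) (rmul (Alg K s) (ee K s i))
    (fun c => LinearMap.mem_range_self _ c)

/-- The homomorphism `P_j → P_i` given by right multiplication with (the class of)
a path `w` from vertex `i` to vertex `j`; concretely it is `x ↦ x * w * e_i`, which
for an actual path `w` from `i` to `j` (so that `w * e_i = w` holds in `R_s`) is just
right multiplication `x ↦ x * w`. -/
noncomputable def pmul (i j : ZMod (6 * s)) (w : Alg K s) :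
    ↥(P K s j) →ₗ[Alg K s] ↥(P K s i) :=
  (toP K s i).comp ((rmul (Alg K s) w).comp (P K s j).subtype)

/-- `α`-arrows of `R_s`, indexed by natural numbers. -/
noncomputable def aN (k : ℕ) : Alg K s := aa K s ((k : ℕ) : ZMod (3 * s))

/-- `β`-arrows of `R_s`, indexed by natural numbers. -/
noncomputable def bN (k : ℕ) : Alg K s := bb K s ((k : ℕ) : ZMod (3 * s))

/-- `γ`-arrows of `R_s`, indexed by natural numbers. -/
noncomputable def gN (k : ℕ) : Alg K s := gg K s ((k : ℕ) : ZMod s)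

/-- The homomorphism `P_j → P_i` (vertices given by natural numbers, taken mod `6s`)
induced by right multiplication with `w`. -/
noncomputable def pmulN (i j : ℕ) (w : Alg K s) :
    ↥(P K s ((j : ℕ) : ZMod (6 * s))) →ₗ[Alg K s] ↥(P K s ((i : ℕ) : ZMod (6 * s))) :=
  pmul K s ((i : ℕ) : ZMod (6 * s)) ((j : ℕ) : ZMod (6 * s)) w

/-- The canonical projection `P_i → S_i` (vertex given by a natural number). -/
noncomputable def toSN (i : ℕ) :
    ↥(P K s ((i : ℕ) : ZMod (6 * s))) →ₗ[Alg K s] S K s ((i : ℕ) : ZMod (6 * s)) :=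
  toS K s ((i : ℕ) : ZMod (6 * s))

/-- The simple module `S_i`, for a vertex given by a natural number. -/
noncomputable def SN (i : ℕ) : Type u := S K s ((i : ℕ) : ZMod (6 * s))

noncomputable instance (i : ℕ) : AddCommGroup (SN K s i) :=
  inferInstanceAs (AddCommGroup (S K s ((i : ℕ) : ZMod (6 * s))))

noncomputable instance (i : ℕ) : Module (Alg K s) (SN K s i) :=
  inferInstanceAs (Module (Alg K s) (S K s ((i : ℕ) : ZMod (6 * s))))

/-! ### Projective resolutions, minimality and syzygies -/

/-- A projective resolution `⋯ → Q 1 → Q 0 → M → 0` of a module `M` over a ring `Λ`. -/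
structure ProjRes (Λ : Type v) [Ring Λ] (M : Type w) [AddCommGroup M] [Module Λ M] where
  /-- The terms of the resolution. -/
  Q : ℕ → Type v
  [acg : ∀ n, AddCommGroup (Q n)]
  [mod : ∀ n, Module Λ (Q n)]
  proj : ∀ n, Module.Projective Λ (Q n)
  /-- The differentials. -/
  d : ∀ n, Q (n + 1) →ₗ[Λ] Q n
  /-- The augmentation. -/
  ε : Q 0 →ₗ[Λ] M
  surj : Function.Surjective ε
  exact₀ : LinearMap.range (d 0) = LinearMap.ker ε
  exact : ∀ n, LinearMap.range (d (n + 1)) = LinearMap.ker (d n)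

attribute [instance] ProjRes.acg ProjRes.mod

/-- A projective resolution is minimal if the image of every differential lies in
`rad(Λ)` times the target. -/
def ProjRes.Minimal {Λ : Type v} [Ring Λ] {M : Type w} [AddCommGroup M]
    [Module Λ M] (res : ProjRes Λ M) : Prop :=
  ∀ n, LinearMap.range (res.d n) ≤ radSMul Λ (res.Q n)

/-- `Ω^p(M) ≅ N` : the `p`-th syzygy of `M` with respect to the projective resolution
`res` is isomorphic to `N` (stated for `p ≥ 1`; here `Ω¹ = ker ε` and
`Ω^p = ker (d (p-2))` for `p ≥ 2`). -/
def ProjRes.SyzygyIso {Λ : Type v} [Ring Λ] {M : Type w} [AddCommGroup M]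
    [Module Λ M] (res : ProjRes Λ M) (p : ℕ) (N : Type*) [AddCommGroup N]
    [Module Λ N] : Prop :=
  (p = 1 ∧ Nonempty (↥(LinearMap.ker res.ε) ≃ₗ[Λ] N)) ∨
  (2 ≤ p ∧ Nonempty (↥(LinearMap.ker (res.d (p - 2))) ≃ₗ[Λ] N))

/-! ### The automorphisms `σ` and `τ`, and twisted bimodules -/

/-- The defining property of the algebra automorphism `σ` of `R_s` :
`σ(e_i) = e_{i+36}` for `i ≡ 0,5 (mod 6)`, `σ(e_i) = e_{i+38}` for `i ≡ 1,2 (mod 6)`,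
`σ(e_i) = e_{i+34}` for `i ≡ 3,4 (mod 6)`; `σ(γ_i) = -γ_{i+6}`;
`σ(α_i) = -β_{i+18}` for `i ≡ 0,1 (mod 3)` and `σ(α_i) = β_{i+18}` for `i ≡ 2 (mod 3)`;
`σ(β_i) = -α_{i+18}` for `i ≡ 1,2 (mod 3)` and `σ(β_i) = α_{i+18}` for `i ≡ 0 (mod 3)`. -/
noncomputable def IsSigma (σ : Alg K s ≃ₐ[K] Alg K s) : Prop :=
  (∀ i : ZMod (6 * s), σ (ee K s i) =
      if i.val % 6 = 0 ∨ i.val % 6 = 5 then ee K s (i + 36)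
      else if i.val % 6 = 1 ∨ i.val % 6 = 2 then ee K s (i + 38)
      else ee K s (i + 34)) ∧
  (∀ i : ZMod s, σ (gg K s i) = -gg K s (i + 6)) ∧
  (∀ i : ZMod (3 * s), σ (aa K s i) =
      if i.val % 3 = 2 then bb K s (i + 18) else -bb K s (i + 18)) ∧
  (∀ i : ZMod (3 * s), σ (bb K s i) =
      if i.val % 3 = 0 then aa K s (i + 18) else -aa K s (i + 18))

/-- The underlying type of the twisted bimodule `₁R_σ` : the linear space `R_s` with
the ordinary left action of `R_s` and the right action twisted by `σ`. -/
def Twisted (_σ : Alg K s ≃ₐ[K] Alg K s) : Type u := Alg K s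

variable {K s} in
/-- The identity map `R_s → ₁R_σ`. -/
def Twisted.mk (σ : Alg K s ≃ₐ[K] Alg K s) (x : Alg K s) : Twisted K s σ := x

variable {K s} in
/-- The identity map `₁R_σ → R_s`. -/
def Twisted.un (σ : Alg K s ≃ₐ[K] Alg K s) (x : Twisted K s σ) : Alg K s := x

section TwistedInstances

variable (σ : Alg K s ≃ₐ[K] Alg K s)

noncomputable instance : AddCommGroup (Twisted K s σ) :=
  inferInstanceAs (AddCommGroup (Alg K s))

noncomputable instance : Module K (Twisted K s σ) :=
  inferInstanceAs (Module K (Alg K s))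

noncomputable instance : Module (Alg K s) (Twisted K s σ) :=
  inferInstanceAs (Module (Alg K s) (Alg K s))

/-- The right action on `₁R_σ` : `(op b) • m = m * σ(b)`. -/
noncomputable instance : Module (Alg K s)ᵐᵒᵖ (Twisted K s σ) :=
  Module.compHom (Alg K s) (RingHom.op (σ : Alg K s →+* Alg K s))

variable {K s σ} in
theorem Twisted.op_smul_def (b : (Alg K s)ᵐᵒᵖ) (m : Twisted K s σ) :
    b • m = Twisted.mk σ (Twisted.un σ m * σ b.unop) :=
  rfl

noncomputable instance : IsScalarTower K (Alg K s) (Twisted K s σ) :=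
  inferInstanceAs (IsScalarTower K (Alg K s) (Alg K s))

noncomputable instance : IsScalarTower K (Alg K s)ᵐᵒᵖ (Twisted K s σ) where
  smul_assoc k b m := by
    rw [Twisted.op_smul_def, Twisted.op_smul_def, MulOpposite.unop_smul, map_smul]
    show Twisted.un σ m * k • σ b.unop = k • (Twisted.un σ m * σ b.unop)
    rw [mul_smul_comm]

noncomputable instance : SMulCommClass (Alg K s) (Alg K s)ᵐᵒᵖ (Twisted K s σ) where
  smul_comm a b m := by
    rw [Twisted.op_smul_def]
    show Twisted.mk σ (a * (Twisted.un σ m * σ b.unop)) =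
      b • Twisted.mk σ (a * Twisted.un σ m)
    rw [Twisted.op_smul_def]
    show Twisted.mk σ (a * (Twisted.un σ m * σ b.unop)) =
      Twisted.mk σ ((a * Twisted.un σ m) * σ b.unop)
    rw [mul_assoc]

/-- The twisted bimodule `₁R_σ` as a module over the enveloping algebra `Λ`. -/
noncomputable instance : Module (Env K s) (Twisted K s σ) :=
  TensorProduct.Algebra.module

end TwistedInstances

/-- The defining property of the automorphism `τ` of `R_s` : `τ` fixes all `e_i`
and all `γ_i`, and `τ(α_i) = -α_i`, `τ(β_i) = -β_i` for `i ≡ 0,2 (mod 3)` while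
`τ(α_i) = α_i`, `τ(β_i) = β_i` for `i ≡ 1 (mod 3)`. -/
noncomputable def IsTau (τ : Alg K s ≃ₐ[K] Alg K s) : Prop :=
  (∀ i : ZMod (6 * s), τ (ee K s i) = ee K s i) ∧
  (∀ i : ZMod s, τ (gg K s i) = gg K s i) ∧
  (∀ i : ZMod (3 * s), τ (aa K s i) =
      if i.val % 3 = 1 then aa K s i else -aa K s i) ∧
  (∀ i : ZMod (3 * s), τ (bb K s i) =
      if i.val % 3 = 1 then bb K s i else -bb K s i)


/-- The `t`-th Hochschild cohomology group `HH^t(R_s) = Ext_Λ^t(R_s, R_s)` of `R_s`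
with coefficients in `R_s`, where `Λ = R_s ⊗ₖ R_sᵐᵒᵖ` is the enveloping algebra. -/
noncomputable def HH (K : Type u) [Field K] (s t : ℕ) : ModuleCat.{u} K :=
  ((Ext K (ModuleCat.{u} (Env K s)) t).obj
      (Opposite.op (ModuleCat.of (Env K s) (Alg K s)))).obj
    (ModuleCat.of (Env K s) (Alg K s))

/-- The dimensions of `HH^t(R_1)`, as stated (`p` = characteristic of `K`). -/
def hhDim1 (p t : ℕ) : ℕ :=
  let L := t / 11
  let r := t % 11
  let ev : Bool := L % 2 == 0
  if t == 0 then 7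
  else if ((r == 0 || r == 6) && ev && p == 3) ||
      ((r == 4 || r == 10) && !ev && p == 3) then 2
  else if ((r == 0 || r == 6) && ev && !(p == 3)) ||
      (r == 1 || r == 9) ||
      ((r == 2 || r == 3) && !ev) ||
      ((r == 3 || r == 4) && ev && p == 2) ||
      ((r == 4 || r == 10) && !ev && !(p == 3)) ||
      (r == 5 && p == 3) ||
      ((r == 6 || r == 7) && !ev && p == 2) ||
      ((r == 7 || r == 8) && ev) then 1
  else 0

section HochschildCohomology

open CategoryTheory

/-- Codes of the paths of `R_1`: the class of a nonzero path with source `i`, target `j` and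
length `l` has code `100 * i + 10 * j + l`. -/
def paths : List ℕ :=
  [0, 11, 31, 22, 42, 53, 4, 110, 121, 152, 103, 114, 220, 251, 202, 213, 224, 330, 341, 352,
    303, 334, 440, 451, 402, 433, 444, 550, 501, 512, 532, 523, 543, 554]

/-- The sum of the numbers `2 ^ c` for the codes `c` of paths. -/
def pathMask : ℕ := 62682480203189659505144964452136864808265955021648952279305770408387952995605689629815037844803601651059529262900091243573396061769789357932068254341481135804321368081

/-- Whether a number is the code of a path. -/
def isPath (c : ℕ) : Bool := Nat.beq ((pathMask >>> c) % 2) 1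

/-- The product `x * y` of two paths (first `y`, then `x`), on codes; `999` stands for zero. -/
def mulc (x y : ℕ) : ℕ :=
  if (y / 10 % 10 == x / 100) && isPath (y / 100 * 100 + x / 10 % 10 * 10 + (x % 10 + y % 10))
      && isPath x && isPath y then
    y / 100 * 100 + x / 10 % 10 * 10 + (x % 10 + y % 10)
  else 999

/-- The last arrow of a path of positive length. -/
def lastArrow (c : ℕ) : ℕ :=
  let j := c / 10 % 10
  if j = 0 then 501 else if j = 1 then 11 else if j = 2 then 121 else if j = 3 then 31
  else if j = 4 then 341 else if c / 100 = 3 ∨ c / 100 = 4 then 451 else 251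

/-- The path obtained by removing the last arrow. -/
def initPath (c : ℕ) : ℕ := c / 100 * 100 + lastArrow c / 100 * 10 + (c % 10 - 1)

/-- The code of a generator. -/
def genCode : Gen 1 → ℕ
  | .e i => 110 * i.val
  | .a i => if i.val = 0 then 11 else if i.val = 1 then 121 else 251
  | .b i => if i.val = 0 then 31 else if i.val = 1 then 341 else 451
  | .g _ => 501

/-- The class of a generator, given by its code. -/
noncomputable def arr (c : ℕ) : Alg K 1 :=
  if c = 11 then aN K 1 0 else if c = 121 then aN K 1 1 else if c = 251 then aN K 1 2
  else if c = 31 then bN K 1 0 else if c = 341 then bN K 1 1 else if c = 451 then bN K 1 2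
  else if c = 501 then gN K 1 0 else ee K 1 ((c / 110 : ℕ) : ZMod (6 * 1))

/-- Auxiliary recursion for `pth`. -/
noncomputable def pthAux : ℕ → ℕ → Alg K 1
  | 0, c => arr K (c / 100 * 110)
  | l + 1, c => arr K (lastArrow c) * pthAux l (initPath c)

/-- The class in `R_1` of the path with the given code (zero if the code is invalid). -/
noncomputable def pth (c : ℕ) : Alg K 1 := if isPath c then pthAux K (c % 10) c else 0

theorem arr_genCode (g : Gen 1) :
    RingQuot.mkAlgHom K (Rel K 1) (FreeAlgebra.ι K g) = arr K (genCode g) := by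
  cases g with
  | e i =>
    have h : ∀ i : Fin 6, genCode (Gen.e i) = 110 * i.val := fun _ => rfl
    change ZMod (6 * 1) at i
    have : ee K 1 i = arr K (genCode (.e i)) := by
      change Fin 6 at i
      fin_cases i <;> rw [arr] <;> simp [h] <;> rfl
    exact this
  | a i =>
    change Fin 3 at i
    fin_cases i <;> simp [genCode, ZMod.val, arr] <;> rfl
  | b i =>
    change Fin 3 at i
    fin_cases i <;> simp [genCode, ZMod.val, arr] <;> rfl
  | g i =>
    change Fin 1 at i
    fin_cases i
    rfl

/-- The codes of the arrows. -/
def arrowCodes : List ℕ := [11, 121, 251, 31, 341, 451, 501]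

theorem arr_idem (i j : Fin 6) :
    arr K (110 * i.val) * arr K (110 * j.val) = if i = j then arr K (110 * i.val) else 0 := by
  have h := RingQuot.mkAlgHom_rel K (Rel.idem (K := K) (s := 1) i j)
  have e (i : Fin 6) : RingQuot.mkAlgHom K (Rel K 1) (E K 1 i) = arr K (110 * i.val) :=
    arr_genCode K (Gen.e i)
  rw [map_mul] at h
  erw [e, e] at h
  rw [h]
  by_cases hij : i = j
  · rw [if_pos hij, ← e, if_pos]
    exact hij
  · rw [if_neg hij, ← map_zero (RingQuot.mkAlgHom K (Rel K 1)), if_neg]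
    exact hij

theorem sum_arr : ∑ i : Fin 6, arr K (110 * i.val) = 1 := by
  have h := RingQuot.mkAlgHom_rel K (Rel.sum_one (K := K) (s := 1))
  rw [map_sum, map_one, Finset.sum_range] at h
  refine Eq.trans (Finset.sum_congr rfl fun (i : Fin 6) _ => ?_) h
  refine (arr_genCode K (Gen.e (s := 1) i)).symm.trans ?_
  congr 3
  fin_cases i <;> rfl

theorem arr_tgt {c : ℕ} (hc : c ∈ arrowCodes) : arr K (c / 10 % 10 * 110) * arr K c = arr K c := by
  have ha (i : Fin 3) := RingQuot.mkAlgHom_rel K (Rel.a_tgt (K := K) (s := 1) i)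
  have hb (i : Fin 3) := RingQuot.mkAlgHom_rel K (Rel.b_tgt (K := K) (s := 1) i)
  have hg (i : Fin 1) := RingQuot.mkAlgHom_rel K (Rel.g_tgt (K := K) (s := 1) i)
  simp only [map_mul] at ha hb hg
  simp only [arrowCodes, List.mem_cons, List.not_mem_nil, or_false] at hc
  have e (i : Fin 6) : RingQuot.mkAlgHom K (Rel K 1) (E K 1 i) = arr K (110 * i.val) :=
    arr_genCode K (Gen.e i)
  have a (i : Fin 3) : RingQuot.mkAlgHom K (Rel K 1) (A K 1 i) = arr K (genCode (.a i)) :=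
    arr_genCode K (Gen.a i)
  have b (i : Fin 3) : RingQuot.mkAlgHom K (Rel K 1) (B K 1 i) = arr K (genCode (.b i)) :=
    arr_genCode K (Gen.b i)
  have g (i : Fin 1) : RingQuot.mkAlgHom K (Rel K 1) (G K 1 i) = arr K (genCode (.g i)) :=
    arr_genCode K (Gen.g i)
  have ha' (i : Fin 3) := (congrArg₂ (· * ·) (e (aTgt 1 i)) (a i)).symm.trans ((ha i).trans (a i))
  have hb' (i : Fin 3) := (congrArg₂ (· * ·) (e (bTgt 1 i)) (b i)).symm.trans ((hb i).trans (b i))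
  have hg' (i : Fin 1) := (congrArg₂ (· * ·) (e (gTgt 1 i)) (g i)).symm.trans ((hg i).trans (g i))
  rcases hc with rfl | rfl | rfl | rfl | rfl | rfl | rfl
  exacts [ha' 0, ha' 1, ha' 2, hb' 0, hb' 1, hb' 2, hg' 0]

theorem arr_src {c : ℕ} (hc : c ∈ arrowCodes) : arr K c * arr K (c / 100 * 110) = arr K c := by
  have ha (i : Fin 3) := RingQuot.mkAlgHom_rel K (Rel.a_src (K := K) (s := 1) i)
  have hb (i : Fin 3) := RingQuot.mkAlgHom_rel K (Rel.b_src (K := K) (s := 1) i)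
  have hg (i : Fin 1) := RingQuot.mkAlgHom_rel K (Rel.g_src (K := K) (s := 1) i)
  simp only [map_mul] at ha hb hg
  simp only [arrowCodes, List.mem_cons, List.not_mem_nil, or_false] at hc
  have e (i : Fin 6) : RingQuot.mkAlgHom K (Rel K 1) (E K 1 i) = arr K (110 * i.val) :=
    arr_genCode K (Gen.e i)
  have a (i : Fin 3) : RingQuot.mkAlgHom K (Rel K 1) (A K 1 i) = arr K (genCode (.a i)) :=
    arr_genCode K (Gen.a i)
  have b (i : Fin 3) : RingQuot.mkAlgHom K (Rel K 1) (B K 1 i) = arr K (genCode (.b i)) :=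
    arr_genCode K (Gen.b i)
  have g (i : Fin 1) : RingQuot.mkAlgHom K (Rel K 1) (G K 1 i) = arr K (genCode (.g i)) :=
    arr_genCode K (Gen.g i)
  have ha' (i : Fin 3) := (congrArg₂ (· * ·) (a i) (e (aSrc 1 i))).symm.trans ((ha i).trans (a i))
  have hb' (i : Fin 3) := (congrArg₂ (· * ·) (b i) (e (bSrc 1 i))).symm.trans ((hb i).trans (b i))
  have hg' (i : Fin 1) := (congrArg₂ (· * ·) (g i) (e (gSrc 1 i))).symm.trans ((hg i).trans (g i))
  rcases hc with rfl | rfl | rfl | rfl | rfl | rfl | rfl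
  exacts [ha' 0, ha' 1, ha' 2, hb' 0, hb' 1, hb' 2, hg' 0]

theorem exists_arrow {c : ℕ} (hc : c ∈ arrowCodes) :
    ∃ x ∈ arrows K 1, RingQuot.mkAlgHom K (Rel K 1) x = arr K c := by
  simp only [arrowCodes, List.mem_cons, List.not_mem_nil, or_false] at hc
  rcases hc with rfl | rfl | rfl | rfl | rfl | rfl | rfl
  · exact ⟨_, .inl (.inl ⟨(0 : Fin 3), rfl⟩), arr_genCode K (Gen.a (0 : Fin 3))⟩
  · exact ⟨_, .inl (.inl ⟨(1 : Fin 3), rfl⟩), arr_genCode K (Gen.a (1 : Fin 3))⟩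
  · exact ⟨_, .inl (.inl ⟨(2 : Fin 3), rfl⟩), arr_genCode K (Gen.a (2 : Fin 3))⟩
  · exact ⟨_, .inl (.inr ⟨(0 : Fin 3), rfl⟩), arr_genCode K (Gen.b (0 : Fin 3))⟩
  · exact ⟨_, .inl (.inr ⟨(1 : Fin 3), rfl⟩), arr_genCode K (Gen.b (1 : Fin 3))⟩
  · exact ⟨_, .inl (.inr ⟨(2 : Fin 3), rfl⟩), arr_genCode K (Gen.b (2 : Fin 3))⟩
  · exact ⟨_, .inr ⟨(0 : Fin 1), rfl⟩, arr_genCode K (Gen.g (0 : Fin 1))⟩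

theorem arr_len5 {c₁ c₂ c₃ c₄ c₅ : ℕ} (h₁ : c₁ ∈ arrowCodes) (h₂ : c₂ ∈ arrowCodes)
    (h₃ : c₃ ∈ arrowCodes) (h₄ : c₄ ∈ arrowCodes) (h₅ : c₅ ∈ arrowCodes) (y : Alg K 1) :
    arr K c₁ * (arr K c₂ * (arr K c₃ * (arr K c₄ * (arr K c₅ * y)))) = 0 := by
  obtain ⟨x₁, m₁, e₁⟩ := exists_arrow K h₁
  obtain ⟨x₂, m₂, e₂⟩ := exists_arrow K h₂
  obtain ⟨x₃, m₃, e₃⟩ := exists_arrow K h₃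
  obtain ⟨x₄, m₄, e₄⟩ := exists_arrow K h₄
  obtain ⟨x₅, m₅, e₅⟩ := exists_arrow K h₅
  have h := RingQuot.mkAlgHom_rel K (Rel.len5 x₁ x₂ x₃ x₄ x₅ m₁ m₂ m₃ m₄ m₅)
  simp only [map_mul, map_zero, e₁, e₂, e₃, e₄, e₅] at h
  simp only [← mul_assoc, h, zero_mul]

theorem arr_comm : arr K 251 * (arr K 121 * arr K 11) = arr K 451 * (arr K 341 * arr K 31) := by
  have h := RingQuot.mkAlgHom_rel K (Rel.comm (K := K) (s := 1) 0)
  simp only [map_mul, mul_assoc] at h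
  exact h

theorem arr_agb : arr K 11 * (arr K 501 * arr K 451) = 0 := by
  have h := RingQuot.mkAlgHom_rel K (Rel.zero_agb (K := K) (s := 1) 0)
  simp only [map_mul, mul_assoc, map_zero] at h
  exact h

theorem arr_bga : arr K 31 * (arr K 501 * arr K 251) = 0 := by
  have h := RingQuot.mkAlgHom_rel K (Rel.zero_bga (K := K) (s := 1) 0)
  simp only [map_mul, mul_assoc, map_zero] at h
  exact h

theorem isPath_iff {c : ℕ} : isPath c = true ↔ c ∈ paths := by
  by_cases hc : c < 555
  · have h : ∀ c < 555, (isPath c = true ↔ c ∈ paths) := by decide +kernel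
    exact h c hc
  · have h : ∀ c ∈ paths, c < 555 := by decide
    have h' : pathMask < 2 ^ c := lt_of_lt_of_le (b := 2 ^ 555) (by decide +kernel)
      (Nat.pow_le_pow_right (by decide) (not_lt.1 hc))
    refine iff_of_false ?_ fun hp => hc (h c hp)
    rw [isPath, Nat.shiftRight_eq_div_pow, Nat.div_eq_of_lt h']
    decide

theorem pth_eq_zero {c : ℕ} (h : c ∉ paths) : pth K c = 0 := by
  rw [pth, if_neg (by rwa [isPath_iff])]

theorem pth_junk : pth K 999 = 0 := pth_eq_zero K (by decide)

theorem pth_vertex (i : Fin 6) : pth K (110 * i.val) = arr K (110 * i.val) := by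
  fin_cases i <;> rfl

theorem pth_succ {c l : ℕ} (h : c ∈ paths) (hl : c % 10 = l + 1) :
    pth K c = arr K (lastArrow c) * pthAux K l (initPath c) := by
  rw [pth, if_pos (isPath_iff.2 h), hl, pthAux]

theorem arr_mul_arr_ne {i j : ℕ} (hi : i < 6) (hj : j < 6) (h : i ≠ j) :
    arr K (i * 110) * arr K (j * 110) = 0 := by
  have := arr_idem K ⟨i, hi⟩ ⟨j, hj⟩
  rwa [if_neg (by simpa using h), mul_comm 110, mul_comm 110] at this

theorem arr_tgt_mul_pth {c : ℕ} (h : c ∈ paths) :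
    arr K (c / 10 % 10 * 110) * pth K c = pth K c := by
  rcases hl : c % 10 with _ | l
  · have h1 : ∀ c ∈ paths, c % 10 = 0 → ∃ i : Fin 6, c = 110 * i.val ∧ c / 10 % 10 = i.val := by
      decide
    obtain ⟨i, rfl, h2⟩ := h1 c h hl
    rw [h2, pth_vertex, mul_comm i.val, arr_idem, if_pos rfl]
  · have h1 : ∀ c ∈ paths, c % 10 ≠ 0 →
      lastArrow c ∈ arrowCodes ∧ c / 10 % 10 = lastArrow c / 10 % 10 := by decide
    obtain ⟨h2, h3⟩ := h1 c h (by omega)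
    rw [pth_succ K h hl, h3, ← mul_assoc, arr_tgt K h2]

theorem vertex_mul_pth (i : Fin 6) (c : ℕ) :
    arr K (110 * i.val) * pth K c = pth K (mulc (110 * i.val) c) := by
  by_cases h : c ∈ paths
  · have h1 : ∀ c ∈ paths, c / 10 % 10 < 6 ∧ ∀ i : Fin 6,
      mulc (110 * i.val) c = if i.val = c / 10 % 10 then c else 999 := by decide +kernel
    obtain ⟨h2, h3⟩ := h1 c h
    rw [h3 i]
    split_ifs with h4
    · rw [mul_comm, h4, arr_tgt_mul_pth K h]
    · rw [← arr_tgt_mul_pth K h, ← mul_assoc, mul_comm 110, arr_mul_arr_ne K i.2 h2 h4, zero_mul,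
        pth_junk]
  · rw [pth_eq_zero K h, mul_zero, mulc, if_neg (by simp [isPath_iff, h]), pth_junk]

theorem arrow_mul_pth {a : ℕ} (ha : a ∈ arrowCodes) (c : ℕ) :
    arr K a * pth K c = pth K (mulc a c) := by
  by_cases h : c ∈ paths
  · have h1 : ∀ a ∈ arrowCodes, ∀ c ∈ paths,
        (a / 100 < 6 ∧ c / 10 % 10 < 6 ∧ a / 100 ≠ c / 10 % 10 ∧ mulc a c = 999) ∨
        (c % 10 = 4 ∧ mulc a c = 999 ∧ lastArrow c ∈ arrowCodes ∧
          lastArrow (initPath c) ∈ arrowCodes ∧ lastArrow (initPath (initPath c)) ∈ arrowCodes ∧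
          lastArrow (initPath (initPath (initPath c))) ∈ arrowCodes) ∨
        (mulc a c ∈ paths ∧ lastArrow (mulc a c) = a ∧ initPath (mulc a c) = c ∧
          mulc a c % 10 = c % 10 + 1) ∨
        (a, c) ∈ [(11, 402), (11, 303), (31, 202), (31, 103), (451, 42), (451, 543)] := by
      decide +kernel
    rcases h1 a ha c h with ⟨h2, h3, h4, h5⟩ | ⟨h2, h3, h4, h5, h6, h7⟩ | ⟨h2, h3, h4, h5⟩ | h2
    · rw [h5, pth_junk, ← arr_tgt_mul_pth K h, ← arr_src K ha, mul_assoc, ← mul_assoc (arr K _) _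
        (pth K c), arr_mul_arr_ne K h2 h3 h4, zero_mul, mul_zero]
    · rw [h3, pth_junk, pth_succ K h h2]
      exact arr_len5 K ha h4 h5 h6 h7 _
    · rw [pth_succ K h2 h5, h3, h4, pth, if_pos (isPath_iff.2 h)]
    · have ab := arr_agb K
      have ba := arr_bga K
      have cm := arr_comm K
      simp only [List.mem_cons, Prod.mk.injEq, List.not_mem_nil, or_false] at h2
      rcases h2 with ⟨rfl, rfl⟩ | ⟨rfl, rfl⟩ | ⟨rfl, rfl⟩ | ⟨rfl, rfl⟩ | ⟨rfl, rfl⟩ | ⟨rfl, rfl⟩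
      · refine Eq.trans (b := arr K 11 * (arr K 501 * arr K 451) * arr K 440) ?_ ?_
        · rw [mul_assoc, mul_assoc]; rfl
        · rw [ab, zero_mul]; exact (pth_junk K).symm
      · refine Eq.trans (b := arr K 11 * (arr K 501 * arr K 451) * (arr K 341 * arr K 330)) ?_ ?_
        · rw [mul_assoc, mul_assoc]; rfl
        · rw [ab, zero_mul]; exact (pth_junk K).symm
      · refine Eq.trans (b := arr K 31 * (arr K 501 * arr K 251) * arr K 220) ?_ ?_
        · rw [mul_assoc, mul_assoc]; rfl
        · rw [ba, zero_mul]; exact (pth_junk K).symm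
      · refine Eq.trans (b := arr K 31 * (arr K 501 * arr K 251) * (arr K 121 * arr K 110)) ?_ ?_
        · rw [mul_assoc, mul_assoc]; rfl
        · rw [ba, zero_mul]; exact (pth_junk K).symm
      · refine Eq.trans (b := arr K 451 * (arr K 341 * arr K 31) * arr K 0) ?_ ?_
        · rw [mul_assoc, mul_assoc]; rfl
        · rw [← cm, mul_assoc, mul_assoc]; rfl
      · refine Eq.trans (b := arr K 451 * (arr K 341 * arr K 31) * (arr K 501 * arr K 550)) ?_ ?_
        · rw [mul_assoc, mul_assoc]; rfl
        · rw [← cm, mul_assoc, mul_assoc]; rfl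
  · rw [pth_eq_zero K h, mul_zero, mulc, if_neg (by simp [isPath_iff, h]), pth_junk]

theorem arr_mul_pth {a : ℕ} (ha : a ∈ arrowCodes ∨ ∃ i : Fin 6, a = 110 * i.val) (c : ℕ) :
    arr K a * pth K c = pth K (mulc a c) := by
  rcases ha with ha | ⟨i, rfl⟩
  · exact arrow_mul_pth K ha c
  · exact vertex_mul_pth K i c

theorem mulc_of_right {y : ℕ} (h : y ∉ paths) (x : ℕ) : mulc x y = 999 := by
  rw [mulc, if_neg (by simp [isPath_iff, h])]

theorem mulc_of_left {x : ℕ} (h : x ∉ paths) (y : ℕ) : mulc x y = 999 := by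
  rw [mulc, if_neg (by simp [isPath_iff, h])]

theorem pth_mul_aux (l : ℕ) {x y : ℕ} (hx : x ∈ paths) (hl : x % 10 = l) (hy : y ∈ paths) :
    pth K x * pth K y = pth K (mulc x y) := by
  induction l generalizing x with
  | zero =>
    have h1 : ∀ x ∈ paths, x % 10 = 0 → ∃ i : Fin 6, x = 110 * i.val := by decide
    obtain ⟨i, rfl⟩ := h1 x hx hl
    rw [pth_vertex, vertex_mul_pth]
  | succ l ih =>
    have h1 : ∀ x ∈ paths, x % 10 ≠ 0 → lastArrow x ∈ arrowCodes ∧ initPath x ∈ paths ∧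
        initPath x % 10 = x % 10 - 1 ∧
        ∀ y ∈ paths, mulc (lastArrow x) (mulc (initPath x) y) = mulc x y := by decide +kernel
    obtain ⟨h2, h3, h4, h5⟩ := h1 x hx (by omega)
    have h6 := pth_succ K hx hl
    have h7 : initPath x % 10 = l := by omega
    have h8 : pth K (initPath x) = pthAux K l (initPath x) := by
      rw [pth, if_pos (isPath_iff.2 h3), h7]
    rw [← h5 y hy, ← arrow_mul_pth K h2, ← ih h3 h7, ← mul_assoc, h6, h8]

theorem pth_mul (x y : ℕ) : pth K x * pth K y = pth K (mulc x y) := by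
  by_cases hx : x ∈ paths
  · by_cases hy : y ∈ paths
    · exact pth_mul_aux K _ hx rfl hy
    · rw [mulc_of_right hy, pth_eq_zero K hy, pth_junk, mul_zero]
  · rw [mulc_of_left hx, pth_eq_zero K hx, pth_junk, zero_mul]

theorem sum_pth : ∑ i : Fin 6, pth K (110 * i.val) = 1 := by
  simp only [pth_vertex, sum_arr]

/-- The nonzero paths, the index set of the standard basis of `R_1`. -/
abbrev Pth : Type := {c : ℕ // c ∈ paths}

/-- The basis vector of the regular representation attached to a path code. -/
noncomputable def vec (c : ℕ) : Pth →₀ K := if h : c ∈ paths then Finsupp.single ⟨c, h⟩ 1 else 0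

/-- Left multiplication by a path in the regular representation. -/
noncomputable def leftMul (a : ℕ) : Module.End K (Pth →₀ K) :=
  Finsupp.linearCombination K fun c : Pth => vec K (mulc a c)

theorem leftMul_vec (a c : ℕ) : leftMul K a (vec K c) = vec K (mulc a c) := by
  by_cases h : c ∈ paths
  · rw [vec, dif_pos h, leftMul, Finsupp.linearCombination_single, one_smul]
  · rw [vec, dif_neg h, map_zero, mulc_of_right h, vec, dif_neg (by decide)]

theorem vec_ext {f g : Module.End K (Pth →₀ K)} (h : ∀ c ∈ paths, f (vec K c) = g (vec K c)) :
    f = g := by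
  refine Finsupp.lhom_ext' fun c => LinearMap.ext_ring ?_
  have := h c c.2
  rwa [vec, dif_pos c.2] at this

theorem leftMul_mul {a b m : ℕ} (h : ∀ c ∈ paths, mulc a (mulc b c) = mulc m c) :
    leftMul K a * leftMul K b = leftMul K m :=
  vec_ext K fun c hc => by simp only [Module.End.mul_apply, leftMul_vec, h c hc]

theorem leftMul_junk : leftMul K 999 = 0 :=
  vec_ext K fun c hc => by
    rw [leftMul_vec, mulc_of_left (by decide), vec, dif_neg (by decide), LinearMap.zero_apply]

/-- The regular representation on the free algebra. -/
noncomputable def regFree : F K 1 →ₐ[K] Module.End K (Pth →₀ K) :=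
  FreeAlgebra.lift K fun g => leftMul K (genCode g)

theorem regFree_ι (g : Gen 1) : regFree K (FreeAlgebra.ι K g) = leftMul K (genCode g) :=
  FreeAlgebra.lift_ι_apply _ _

theorem regFree_arrow {x : F K 1} (h : x ∈ arrows K 1) :
    ∃ c ∈ arrowCodes, regFree K x = leftMul K c := by
  rcases h with (⟨i, rfl⟩ | ⟨i, rfl⟩) | ⟨i, rfl⟩
  · refine ⟨_, ?_, regFree_ι K (.a i)⟩
    change Fin 3 at i
    revert i; decide
  · refine ⟨_, ?_, regFree_ι K (.b i)⟩
    change Fin 3 at i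
    revert i; decide
  · exact ⟨_, by simp [genCode, arrowCodes], regFree_ι K (.g i)⟩

theorem regFree_len5 {c₁ c₂ c₃ c₄ c₅ : ℕ} (h₁ : c₁ ∈ arrowCodes) (h₂ : c₂ ∈ arrowCodes)
    (h₃ : c₃ ∈ arrowCodes) (h₄ : c₄ ∈ arrowCodes) (h₅ : c₅ ∈ arrowCodes) :
    leftMul K c₁ * leftMul K c₂ * leftMul K c₃ * leftMul K c₄ * leftMul K c₅ = 0 := by
  have key : ∀ a ∈ arrowCodes, ∀ c ∈ paths, mulc a c = 999 ∨
      (mulc a c ∈ paths ∧ mulc a c % 10 = c % 10 + 1) := by decide +kernel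
  have key' : ∀ a ∈ arrowCodes, ∀ c l, (c = 999 ∨ c ∈ paths ∧ l ≤ c % 10) →
      (mulc a c = 999 ∨ mulc a c ∈ paths ∧ l + 1 ≤ mulc a c % 10) := by
    rintro a ha c l (rfl | ⟨h1, h2⟩)
    · exact .inl (mulc_of_right (by decide) _)
    · refine (key a ha c h1).imp id fun h => ⟨h.1, by omega⟩
  refine vec_ext K fun c hc => ?_
  simp only [Module.End.mul_apply, leftMul_vec, LinearMap.zero_apply]
  have := key' _ h₁ _ _ (key' _ h₂ _ _ (key' _ h₃ _ _ (key' _ h₄ _ _ (key' _ h₅ _ _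
    (.inr ⟨hc, Nat.zero_le _⟩)))))
  have hl : ∀ c ∈ paths, c % 10 < 5 := by decide
  rcases this with h | ⟨h, h'⟩
  · rw [h, vec, dif_neg (by decide)]
  · have := hl _ h
    omega

theorem regFree_rel ⦃x y : F K 1⦄ (h : Rel K 1 x y) : regFree K x = regFree K y := by
  have e (i : Fin 6) : regFree K (E K 1 i) = leftMul K (110 * i.val) := regFree_ι K (.e i)
  have a (i : Fin 3) : regFree K (A K 1 i) = leftMul K (genCode (.a i)) := regFree_ι K (.a i)
  have b (i : Fin 3) : regFree K (B K 1 i) = leftMul K (genCode (.b i)) := regFree_ι K (.b i)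
  have g (i : Fin 1) : regFree K (G K 1 i) = leftMul K (genCode (.g i)) := regFree_ι K (.g i)
  cases h with
  | idem i j =>
    change Fin 6 at i j
    rw [map_mul]
    refine (congrArg₂ (· * ·) (e i) (e j)).trans ?_
    by_cases h : i = j
    · rw [if_pos (by exact h)]
      refine Eq.trans ?_ (e i).symm
      subst h
      refine leftMul_mul K ?_
      revert i; decide +kernel
    · rw [if_neg (by exact h), map_zero, ← leftMul_junk]
      refine leftMul_mul K ?_
      revert i j; decide +kernel
  | sum_one =>
    rw [map_sum, map_one, Finset.sum_range]
    refine Eq.trans (b := ∑ i : Fin 6, leftMul K (110 * i.val))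
      (Finset.sum_congr rfl fun (i : Fin 6) _ => ?_) (vec_ext K fun c hc => ?_)
    · refine Eq.trans ?_ (e i)
      congr 3
      fin_cases i <;> rfl
    · simp only [LinearMap.sum_apply, leftMul_vec, Module.End.one_apply]
      have h1 : ∀ c ∈ paths, ∃ i : Fin 6, mulc (110 * i.val) c = c ∧
          ∀ j : Fin 6, j ≠ i → mulc (110 * j.val) c = 999 := by decide +kernel
      obtain ⟨i, h2, h3⟩ := h1 c hc
      rw [Finset.sum_eq_single i, h2]
      · intro j _ hj
        rw [h3 j hj, vec, dif_neg (by decide)]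
      · simp
  | a_tgt i =>
    change Fin 3 at i
    rw [map_mul]
    refine (congrArg₂ (· * ·) (e (aTgt 1 i)) (a i)).trans (Eq.trans ?_ (a i).symm)
    exact leftMul_mul K (by revert i; decide +kernel)
  | a_src i =>
    change Fin 3 at i
    rw [map_mul]
    refine (congrArg₂ (· * ·) (a i) (e (aSrc 1 i))).trans (Eq.trans ?_ (a i).symm)
    exact leftMul_mul K (by revert i; decide +kernel)
  | b_tgt i =>
    change Fin 3 at i
    rw [map_mul]
    refine (congrArg₂ (· * ·) (e (bTgt 1 i)) (b i)).trans (Eq.trans ?_ (b i).symm)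
    exact leftMul_mul K (by revert i; decide +kernel)
  | b_src i =>
    change Fin 3 at i
    rw [map_mul]
    refine (congrArg₂ (· * ·) (b i) (e (bSrc 1 i))).trans (Eq.trans ?_ (b i).symm)
    exact leftMul_mul K (by revert i; decide +kernel)
  | g_tgt i =>
    change Fin 1 at i
    rw [map_mul]
    refine (congrArg₂ (· * ·) (e (gTgt 1 i)) (g i)).trans (Eq.trans ?_ (g i).symm)
    exact leftMul_mul K (by revert i; decide +kernel)
  | g_src i =>
    change Fin 1 at i
    rw [map_mul]
    refine (congrArg₂ (· * ·) (g i) (e (gSrc 1 i))).trans (Eq.trans ?_ (g i).symm)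
    exact leftMul_mul K (by revert i; decide +kernel)
  | len5 x₁ x₂ x₃ x₄ x₅ h₁ h₂ h₃ h₄ h₅ =>
    obtain ⟨c₁, m₁, e₁⟩ := regFree_arrow K h₁
    obtain ⟨c₂, m₂, e₂⟩ := regFree_arrow K h₂
    obtain ⟨c₃, m₃, e₃⟩ := regFree_arrow K h₃
    obtain ⟨c₄, m₄, e₄⟩ := regFree_arrow K h₄
    obtain ⟨c₅, m₅, e₅⟩ := regFree_arrow K h₅
    rw [map_mul, map_mul, map_mul, map_mul, e₁, e₂, e₃, e₄, e₅, map_zero,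
      regFree_len5 K m₁ m₂ m₃ m₄ m₅]
  | comm t =>
    change Fin 1 at t
    rw [Subsingleton.elim t 0]
    simp only [map_mul]
    refine (congrArg₂ (· * ·) (congrArg₂ (· * ·) (a 2) (a 1)) (a 0)).trans
      (Eq.trans ?_ (congrArg₂ (· * ·) (congrArg₂ (· * ·) (b 2) (b 1)) (b 0)).symm)
    refine vec_ext K fun c hc => ?_
    simp only [Module.End.mul_apply, leftMul_vec]
    congr 1
    revert c; decide +kernel
  | zero_agb t =>
    change Fin 1 at t
    rw [Subsingleton.elim t 0]
    simp only [map_mul, map_zero]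
    refine (congrArg₂ (· * ·) (congrArg₂ (· * ·) (a 0) (g 0)) (b 2)).trans ?_
    rw [← leftMul_junk]
    refine vec_ext K fun c hc => ?_
    simp only [Module.End.mul_apply, leftMul_vec]
    congr 1
    revert c; decide +kernel
  | zero_bga t =>
    change Fin 1 at t
    rw [Subsingleton.elim t 0]
    simp only [map_mul, map_zero]
    refine (congrArg₂ (· * ·) (congrArg₂ (· * ·) (b 0) (g 0)) (a 2)).trans ?_
    rw [← leftMul_junk]
    refine vec_ext K fun c hc => ?_
    simp only [Module.End.mul_apply, leftMul_vec]
    congr 1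
    revert c; decide +kernel

/-- The regular representation of `R_1`. -/
noncomputable def reg : Alg K 1 →ₐ[K] Module.End K (Pth →₀ K) :=
  RingQuot.liftAlgHom K ⟨regFree K, regFree_rel K⟩

theorem reg_arr (g : Gen 1) : reg K (arr K (genCode g)) = leftMul K (genCode g) := by
  rw [← arr_genCode, reg, RingQuot.liftAlgHom_mkAlgHom_apply, regFree_ι]


theorem arr_mem_span (g : Gen 1) {y : Alg K 1} (hy : y ∈ Submodule.span K (Set.range (pth K))) :
    arr K (genCode g) * y ∈ Submodule.span K (Set.range (pth K)) := by
  induction hy using Submodule.span_induction with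
  | mem x h =>
    obtain ⟨c, rfl⟩ := h
    have hg : genCode g ∈ arrowCodes ∨ ∃ i : Fin 6, genCode g = 110 * i.val := by
      cases g with
      | e i => exact .inr ⟨i, rfl⟩
      | a i => change Fin 3 at i; left; revert i; decide
      | b i => change Fin 3 at i; left; revert i; decide
      | g i => left; simp [genCode, arrowCodes]
    rw [arr_mul_pth K hg]
    exact Submodule.subset_span ⟨_, rfl⟩
  | zero => rw [mul_zero]; exact Submodule.zero_mem _
  | add x y _ _ hx hy => rw [mul_add]; exact Submodule.add_mem _ hx hy
  | smul a x _ hx => rw [mul_smul_comm]; exact Submodule.smul_mem _ _ hx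

theorem mk_mul_mem_span (x : F K 1) :
    ∀ y ∈ Submodule.span K (Set.range (pth K)),
      RingQuot.mkAlgHom K (Rel K 1) x * y ∈ Submodule.span K (Set.range (pth K)) := by
  induction x using FreeAlgebra.induction with
  | grade0 r =>
    intro y hy
    rw [AlgHom.commutes, ← Algebra.smul_def]
    exact Submodule.smul_mem _ _ hy
  | grade1 g =>
    intro y hy
    rw [arr_genCode]
    exact arr_mem_span K g hy
  | mul a b ha hb =>
    intro y hy
    rw [map_mul, mul_assoc]
    exact ha _ (hb _ hy)
  | add a b ha hb =>
    intro y hy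
    rw [map_add, add_mul]
    exact Submodule.add_mem _ (ha _ hy) (hb _ hy)

theorem span_pth : Submodule.span K (Set.range fun c : Pth => pth K c) = ⊤ := by
  have h1 : Submodule.span K (Set.range (pth K)) ≤
      Submodule.span K (Set.range fun c : Pth => pth K c) := by
    rw [Submodule.span_le]
    rintro _ ⟨c, rfl⟩
    by_cases h : c ∈ paths
    · exact Submodule.subset_span ⟨⟨c, h⟩, rfl⟩
    · rw [pth_eq_zero K h]
      exact Submodule.zero_mem _
  rw [eq_top_iff]
  rintro y -
  obtain ⟨x, rfl⟩ := RingQuot.mkAlgHom_surjective K (Rel K 1) y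
  refine h1 ?_
  have h2 := mk_mul_mem_span K x 1 (by
    rw [← sum_pth]
    exact Submodule.sum_mem _ fun i _ => Submodule.subset_span ⟨_, rfl⟩)
  rwa [mul_one] at h2

theorem reg_arr' {a : ℕ} (ha : a ∈ arrowCodes ∨ ∃ i : Fin 6, a = 110 * i.val) :
    reg K (arr K a) = leftMul K a := by
  have : ∃ g : Gen 1, genCode g = a := by
    rcases ha with ha | ⟨i, rfl⟩
    · simp only [arrowCodes, List.mem_cons, List.not_mem_nil, or_false] at ha
      rcases ha with rfl | rfl | rfl | rfl | rfl | rfl | rfl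
      exacts [⟨.a (0 : Fin 3), rfl⟩, ⟨.a (1 : Fin 3), rfl⟩, ⟨.a (2 : Fin 3), rfl⟩,
        ⟨.b (0 : Fin 3), rfl⟩, ⟨.b (1 : Fin 3), rfl⟩, ⟨.b (2 : Fin 3), rfl⟩, ⟨.g (0 : Fin 1), rfl⟩]
    · exact ⟨.e i, rfl⟩
  obtain ⟨g, rfl⟩ := this
  exact reg_arr K g

theorem reg_pth_aux (l : ℕ) {x : ℕ} (hx : x ∈ paths) (hl : x % 10 = l) :
    reg K (pth K x) = leftMul K x := by
  induction l generalizing x with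
  | zero =>
    have h1 : ∀ x ∈ paths, x % 10 = 0 → ∃ i : Fin 6, x = 110 * i.val := by decide
    obtain ⟨i, rfl⟩ := h1 x hx hl
    rw [pth_vertex, reg_arr' K (.inr ⟨i, rfl⟩)]
  | succ l ih =>
    have h1 : ∀ x ∈ paths, x % 10 ≠ 0 → lastArrow x ∈ arrowCodes ∧ initPath x ∈ paths ∧
        initPath x % 10 = x % 10 - 1 ∧
        ∀ y ∈ paths, mulc (lastArrow x) (mulc (initPath x) y) = mulc x y := by decide +kernel
    obtain ⟨h2, h3, h4, h5⟩ := h1 x hx (by omega)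
    have h6 := pth_succ K hx hl
    have h7 : initPath x % 10 = l := by omega
    have h8 : pth K (initPath x) = pthAux K l (initPath x) := by
      rw [pth, if_pos (isPath_iff.2 h3), h7]
    rw [h6, ← h8, map_mul, ih h3 h7, reg_arr' K (.inl h2), leftMul_mul K h5]

/-- The coordinates of an element of `R_1` with respect to the basis of paths. -/
noncomputable def coords : Alg K 1 →ₗ[K] Pth →₀ K :=
  (LinearMap.applyₗ (∑ i : Fin 6, vec K (110 * i.val))).comp (reg K).toLinearMap

theorem coords_pth {c : ℕ} (hc : c ∈ paths) : coords K (pth K c) = vec K c := by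
  change reg K (pth K c) (∑ i : Fin 6, vec K (110 * i.val)) = _
  rw [reg_pth_aux K _ hc rfl, map_sum]
  simp only [leftMul_vec]
  have h1 : ∀ c ∈ paths, ∃ i : Fin 6, mulc c (110 * i.val) = c ∧
      ∀ j : Fin 6, j ≠ i → mulc c (110 * j.val) = 999 := by decide +kernel
  obtain ⟨i, h2, h3⟩ := h1 c hc
  rw [Finset.sum_eq_single i, h2]
  · intro j _ hj
    rw [h3 j hj, vec, dif_neg (by decide)]
  · simp

theorem linearIndependent_pth : LinearIndependent K fun c : Pth => pth K c := by
  refine LinearIndependent.of_comp (coords K) ?_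
  have : coords K ∘ (fun c : Pth => pth K c) = fun c => Finsupp.single c 1 := by
    funext c
    rw [Function.comp, coords_pth K c.2, vec, dif_pos c.2]
  rw [this]
  exact Finsupp.linearIndependent_single_one K Pth

/-- The basis of `R_1` consisting of the nonzero paths. -/
noncomputable def pthBasis : Module.Basis Pth K (Alg K 1) :=
  Module.Basis.mk (linearIndependent_pth K) (span_pth K).ge

theorem pthBasis_apply (c : Pth) : pthBasis K c = pth K c := by
  rw [pthBasis, Module.Basis.mk_apply]

/-- A term `(c, k, p, q)` stands for `c • (p ⊗ q)` in the `k`-th summand of a bimodule. -/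
abbrev Term : Type := ℤ × ℕ × ℕ × ℕ

/-- The vertices `(i, j)` of the summands `R e_i ⊗ e_j R` of the terms of the minimal bimodule
resolution of `R_1` in degrees `0` to `10`. -/
def vertexTable : List (List (ℕ × ℕ)) := [
  [(0, 0), (1, 1), (2, 2), (3, 3), (4, 4), (5, 5)],
  [(0, 5), (1, 0), (2, 1), (3, 0), (4, 3), (5, 2), (5, 4)],
  [(1, 4), (3, 2), (5, 0), (0, 5), (2, 1), (4, 3)],
  [(0, 2), (0, 4), (1, 5), (2, 0), (3, 5), (4, 0), (5, 1), (5, 3)],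
  [(1, 2), (3, 4), (5, 0), (0, 0), (1, 3), (2, 4), (3, 1), (4, 2), (5, 5)],
  [(1, 0), (3, 0), (5, 2), (5, 4), (0, 1), (0, 3), (2, 5), (4, 5)],
  [(0, 0), (1, 1), (2, 2), (3, 3), (4, 4), (5, 5), (0, 5), (2, 3), (4, 1)],
  [(0, 2), (0, 4), (1, 5), (2, 0), (3, 5), (4, 0), (5, 1), (5, 3)],
  [(1, 4), (3, 2), (5, 0), (0, 5), (2, 1), (4, 3)],
  [(0, 1), (0, 3), (1, 4), (2, 5), (3, 2), (4, 5), (5, 0)],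
  [(0, 0), (1, 3), (2, 4), (3, 1), (4, 2), (5, 5)]]

/-- The differentials of the minimal resolution in degrees `0` to `10`: for each generator of the
source, the list of terms of its image. -/
def diffTable : List (List (List Term)) := [
  [[(1, 0, 0, 501), (-1, 5, 501, 550)], [(1, 0, 11, 0), (-1, 1, 110, 11)], [(1, 1, 121, 110),
    (-1, 2, 220, 121)], [(1, 0, 31, 0), (-1, 3, 330, 31)], [(1, 3, 341, 330), (-1, 4, 440, 341)],
    [(1, 2, 251, 220), (-1, 5, 550, 251)], [(1, 4, 451, 440), (-1, 5, 550, 451)]],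
  [[(1, 0, 11, 451), (-1, 1, 110, 402), (-1, 6, 512, 440)], [(1, 0, 31, 251), (-1, 3, 330, 202),
    (-1, 5, 532, 220)], [(1, 1, 152, 0), (1, 2, 251, 11), (-1, 3, 352, 0), (-1, 4, 451, 31),
    (1, 5, 550, 22), (-1, 6, 550, 42)], [(1, 0, 0, 554), (1, 0, 4, 550), (-1, 3, 303, 501),
    (-1, 4, 402, 532), (-1, 6, 501, 543)], [(1, 0, 22, 152), (-1, 1, 121, 103),
    (-1, 2, 220, 114), (-1, 2, 224, 110), (-1, 5, 523, 121)], [(1, 0, 42, 352),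
    (-1, 3, 341, 303), (-1, 4, 440, 334), (-1, 4, 444, 330), (-1, 6, 543, 341)]],
  [[(1, 1, 303, 220), (-1, 3, 0, 251)], [(1, 0, 103, 440), (1, 2, 501, 402), (-1, 3, 0, 451)],
    [(1, 0, 110, 543), (-1, 3, 11, 550)], [(1, 0, 121, 42), (-1, 2, 523, 0), (-1, 4, 220, 11)],
    [(1, 1, 330, 523), (1, 2, 532, 501), (-1, 3, 31, 550)], [(1, 1, 341, 22), (1, 2, 543, 0),
    (-1, 5, 440, 31)], [(1, 1, 352, 121), (-1, 2, 550, 103), (-1, 4, 251, 110)],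
    [(1, 0, 152, 341), (1, 2, 550, 303), (-1, 5, 451, 330)]],
  [[(1, 0, 11, 220), (-1, 2, 110, 251)], [(1, 1, 31, 440), (-1, 4, 330, 451)], [(1, 3, 251, 0),
    (1, 5, 451, 0), (-1, 6, 550, 11), (-1, 7, 550, 31)], [(1, 0, 0, 22), (-1, 1, 0, 42),
    (-1, 5, 402, 0), (1, 7, 501, 31)], [(1, 1, 11, 341), (-1, 2, 110, 352), (-1, 7, 512, 330)],
    [(1, 1, 22, 440), (-1, 2, 121, 451), (1, 3, 220, 402)], [(1, 0, 31, 121), (-1, 4, 330, 152),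
    (-1, 6, 532, 110)], [(1, 0, 42, 220), (-1, 4, 341, 251), (1, 5, 440, 202)],
    [(1, 2, 152, 550), (-1, 4, 352, 550), (1, 5, 451, 501), (-1, 7, 550, 532)]],
  [[(1, 0, 110, 22), (-1, 3, 11, 0), (-1, 4, 110, 31)], [(1, 1, 330, 42), (1, 2, 532, 0),
    (1, 3, 31, 0), (-1, 6, 330, 11)], [(1, 0, 152, 220), (-1, 7, 451, 220), (1, 8, 550, 251)],
    [(1, 1, 352, 440), (1, 2, 550, 402), (-1, 5, 251, 440), (-1, 8, 550, 451)], [(1, 3, 0, 103),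
    (-1, 6, 303, 110), (1, 7, 402, 121)], [(1, 2, 501, 303), (1, 3, 0, 303), (1, 4, 103, 330),
    (-1, 5, 202, 341)], [(1, 4, 121, 532), (-1, 5, 220, 543), (-1, 8, 523, 550)],
    [(1, 2, 543, 501), (-1, 6, 341, 512), (1, 7, 440, 523), (-1, 8, 543, 550)]],
  [[(1, 0, 103, 0), (1, 1, 303, 0), (-1, 2, 501, 22), (-1, 3, 501, 42), (-1, 4, 0, 11),
    (1, 5, 0, 31)], [(1, 0, 110, 103), (1, 4, 11, 110)], [(1, 2, 523, 220), (1, 6, 220, 251)],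
    [(1, 1, 330, 303), (-1, 5, 31, 330)], [(1, 3, 543, 440), (-1, 7, 440, 451)],
    [(1, 0, 152, 501), (1, 1, 352, 501), (-1, 2, 550, 523), (-1, 3, 550, 543), (1, 6, 251, 550),
    (-1, 7, 451, 550)], [(1, 5, 0, 532), (-1, 6, 202, 550)], [(1, 0, 121, 303),
    (-1, 3, 523, 341), (1, 5, 22, 330), (1, 6, 220, 352)], [(1, 1, 341, 103), (-1, 2, 543, 121),
    (-1, 4, 42, 110), (-1, 7, 440, 152)]],
  [[(1, 2, 202, 220), (1, 6, 0, 251)], [(1, 0, 0, 402), (1, 4, 402, 440), (-1, 5, 501, 451),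
    (-1, 6, 0, 451)], [(1, 0, 11, 501), (1, 1, 110, 512), (-1, 5, 512, 550), (-1, 6, 11, 550)],
    [(1, 0, 22, 0), (1, 1, 121, 11), (1, 2, 220, 22), (-1, 7, 220, 31)], [(1, 3, 330, 532),
    (1, 6, 31, 550)], [(1, 0, 42, 0), (1, 3, 341, 31), (1, 4, 440, 42), (-1, 8, 440, 11)],
    [(1, 1, 152, 110), (1, 2, 251, 121), (-1, 5, 550, 152), (1, 8, 451, 110)], [(1, 3, 352, 330),
    (1, 4, 451, 341), (-1, 5, 550, 352), (1, 7, 251, 330)]],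
  [[(1, 1, 11, 440), (-1, 2, 110, 451)], [(1, 0, 31, 220), (-1, 4, 330, 251)], [(1, 3, 251, 0),
    (-1, 5, 451, 0), (-1, 6, 550, 11), (1, 7, 550, 31)], [(1, 0, 0, 523), (1, 1, 0, 543),
    (1, 2, 103, 550), (1, 4, 303, 550), (-1, 5, 402, 501), (-1, 6, 501, 512)], [(1, 0, 22, 121),
    (1, 2, 121, 152), (-1, 3, 220, 103), (-1, 6, 523, 110)], [(1, 1, 42, 341), (1, 4, 341, 352),
    (-1, 5, 440, 303), (-1, 7, 543, 330)]],
  [[(1, 1, 303, 121), (-1, 2, 501, 103), (1, 3, 0, 152), (-1, 4, 202, 110)], [(1, 0, 103, 341),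
    (1, 3, 0, 352), (-1, 5, 402, 330)], [(1, 0, 110, 444), (-1, 0, 114, 440), (-1, 3, 11, 451)],
    [(1, 0, 121, 543), (-1, 3, 22, 550), (1, 4, 220, 512)], [(1, 1, 330, 224), (-1, 1, 334, 220),
    (1, 2, 532, 202), (-1, 3, 31, 251)], [(1, 1, 341, 523), (1, 2, 543, 501), (-1, 3, 42, 550),
    (1, 5, 440, 532)], [(1, 0, 152, 42), (-1, 1, 352, 22), (1, 2, 550, 4), (-1, 2, 554, 0),
    (1, 4, 251, 11), (-1, 5, 451, 31)]],
  [[(1, 0, 0, 11), (-1, 1, 0, 31), (1, 6, 501, 0)], [(1, 1, 11, 330), (1, 2, 110, 341)],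
    [(1, 2, 121, 440), (-1, 3, 220, 451)], [(1, 0, 31, 110), (1, 4, 330, 121)],
    [(1, 4, 341, 220), (-1, 5, 440, 251)], [(1, 3, 251, 550), (-1, 5, 451, 550),
    (-1, 6, 550, 501)]],
  [[(1, 0, 0, 4), (-1, 0, 4, 0), (-1, 1, 103, 31), (1, 2, 202, 42), (1, 3, 303, 11),
    (-1, 4, 402, 22), (1, 5, 501, 53)], [(1, 0, 11, 303), (1, 1, 110, 334), (-1, 1, 114, 330),
    (1, 2, 213, 341), (1, 5, 512, 352)], [(1, 0, 22, 402), (1, 1, 121, 433), (-1, 2, 220, 444),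
    (1, 2, 224, 440), (1, 5, 523, 451)], [(1, 0, 31, 103), (-1, 3, 330, 114), (1, 3, 334, 110),
    (-1, 4, 433, 121), (1, 5, 532, 152)], [(1, 0, 42, 202), (-1, 3, 341, 213), (1, 4, 440, 224),
    (-1, 4, 444, 220), (1, 5, 543, 251)], [(1, 0, 53, 501), (1, 1, 152, 532), (-1, 2, 251, 543),
    (-1, 3, 352, 512), (1, 4, 451, 523), (-1, 5, 550, 554), (1, 5, 554, 550)]]]

/-- The contracting homotopy of the minimal resolution in degrees `0` to `10`: an entry
`(k, p, l)` says that the generator of the `k`-th summand multiplied by `p` on the left is sent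
to `l`. -/
def homotopyTable : List (List (ℕ × ℕ × List Term)) := [
  [(0, 4, [(-1, 0, 0, 53), (1, 1, 103, 0), (1, 2, 202, 11), (1, 5, 501, 22)]),
    (0, 11, [(1, 1, 110, 0)]), (0, 22, [(1, 1, 121, 0), (1, 2, 220, 11)]),
    (0, 31, [(1, 3, 330, 0)]), (0, 42, [(1, 3, 341, 0), (1, 4, 440, 31)]),
    (0, 53, [(1, 1, 152, 0), (1, 2, 251, 11), (1, 5, 550, 22)]), (1, 103, [(-1, 0, 0, 152),
    (1, 2, 202, 110), (1, 5, 501, 121)]), (1, 114, [(-1, 0, 11, 152), (1, 1, 110, 103),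
    (1, 2, 213, 110), (1, 5, 512, 121)]), (1, 121, [(1, 2, 220, 110)]),
    (1, 152, [(1, 2, 251, 110), (1, 5, 550, 121)]), (2, 202, [(-1, 0, 0, 251),
    (1, 5, 501, 220)]), (2, 213, [(-1, 0, 11, 251), (1, 1, 110, 202), (1, 5, 512, 220)]),
    (2, 224, [(-1, 0, 22, 251), (1, 1, 121, 202), (1, 2, 220, 213), (1, 5, 523, 220)]),
    (2, 251, [(1, 5, 550, 220)]), (3, 303, [(-1, 0, 0, 352), (1, 4, 402, 330),
    (1, 6, 501, 341)]), (3, 334, [(-1, 0, 31, 352), (1, 3, 330, 303), (1, 4, 433, 330),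
    (1, 6, 532, 341)]), (3, 341, [(1, 4, 440, 330)]), (3, 352, [(1, 4, 451, 330),
    (1, 6, 550, 341)]), (4, 402, [(-1, 0, 0, 451), (1, 6, 501, 440)]),
    (4, 433, [(-1, 0, 31, 451), (1, 3, 330, 402), (1, 6, 532, 440)]), (4, 444, [(-1, 0, 42, 451),
    (1, 3, 341, 402), (1, 4, 440, 433), (1, 6, 543, 440)]), (4, 451, [(1, 6, 550, 440)]),
    (5, 501, [(-1, 0, 0, 550)]), (5, 512, [(-1, 0, 11, 550), (1, 1, 110, 501)]),
    (5, 523, [(-1, 0, 22, 550), (1, 1, 121, 501), (1, 2, 220, 512)]), (5, 532, [(-1, 0, 31, 550),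
    (1, 3, 330, 501)]), (5, 543, [(-1, 0, 42, 550), (1, 3, 341, 501), (1, 4, 440, 532)]),
    (5, 554, [(-1, 0, 53, 550), (1, 1, 152, 501), (1, 2, 251, 512), (1, 5, 550, 523)])],
  [(0, 4, [(-1, 2, 501, 501), (1, 3, 0, 550)]), (1, 114, [(-1, 0, 110, 42), (1, 2, 512, 0)]),
    (2, 224, [(-1, 4, 220, 110)]), (3, 303, [(-1, 2, 501, 0)]), (3, 334, [(-1, 1, 330, 22),
    (-1, 2, 532, 0)]), (3, 352, [(-1, 2, 550, 0)]), (4, 444, [(-1, 5, 440, 330)]),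
    (5, 532, [(-1, 1, 330, 220)]), (5, 543, [(-1, 1, 341, 220)]), (5, 554, [(-1, 1, 352, 220),
    (1, 2, 550, 202)]), (6, 512, [(-1, 0, 110, 440)]), (6, 523, [(-1, 0, 121, 440)]),
    (6, 554, [(-1, 0, 152, 440)])],
  [(0, 103, [(1, 1, 0, 440)]), (0, 114, [(1, 1, 11, 440), (-1, 2, 110, 451)]),
    (1, 303, [(1, 0, 0, 220)]), (1, 334, [(1, 0, 31, 220), (-1, 4, 330, 251)]),
    (2, 523, [(-1, 3, 220, 0)]), (2, 543, [(1, 5, 440, 0)]), (2, 554, [(-1, 3, 251, 0),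
    (1, 6, 550, 11)]), (3, 4, [(1, 0, 0, 523), (-1, 4, 303, 550)]), (3, 11, [(-1, 2, 110, 550)]),
    (3, 22, [(-1, 2, 121, 550)]), (3, 31, [(-1, 4, 330, 550)]), (3, 42, [(-1, 4, 341, 550),
    (1, 5, 440, 501)]), (3, 53, [(-1, 2, 152, 550)]), (4, 202, [(1, 0, 0, 121),
    (-1, 6, 501, 110)]), (4, 213, [(-1, 6, 512, 110)]), (4, 224, [(1, 3, 220, 103),
    (-1, 6, 523, 110)]), (4, 251, [(-1, 6, 550, 110)]), (5, 402, [(1, 1, 0, 341),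
    (-1, 7, 501, 330)]), (5, 433, [(-1, 7, 532, 330)]), (5, 444, [(1, 5, 440, 303),
    (-1, 7, 543, 330)]), (5, 451, [(-1, 7, 550, 330)])],
  [(0, 4, [(1, 3, 0, 202), (1, 7, 402, 220)]), (0, 11, [(1, 0, 110, 220)]),
    (0, 22, [(1, 0, 121, 220)]), (0, 42, [(1, 7, 440, 220)]), (0, 53, [(1, 0, 152, 220)]),
    (1, 4, [(1, 1, 303, 440)]), (1, 22, [(1, 5, 220, 440)]), (1, 31, [(1, 1, 330, 440)]),
    (1, 42, [(1, 1, 341, 440)]), (1, 53, [(1, 5, 251, 440)]), (2, 103, [(1, 3, 0, 501),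
    (1, 8, 501, 550)]), (2, 114, [(-1, 4, 110, 532), (1, 8, 512, 550)]),
    (3, 202, [(1, 2, 501, 0), (1, 3, 0, 0)]), (3, 213, [(1, 2, 512, 0), (-1, 4, 110, 31)]),
    (3, 224, [(1, 2, 523, 0), (-1, 4, 121, 31), (1, 5, 220, 42)]), (4, 334, [(-1, 1, 330, 543),
    (-1, 3, 31, 501), (-1, 8, 532, 550)]), (4, 352, [(1, 2, 550, 501), (-1, 8, 550, 550)]),
    (5, 402, [(-1, 3, 0, 0)]), (5, 433, [(-1, 1, 330, 42), (-1, 3, 31, 0)]),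
    (5, 444, [(-1, 1, 341, 42), (-1, 3, 42, 0), (1, 7, 440, 22)]), (5, 451, [(1, 2, 550, 0)]),
    (6, 532, [(-1, 6, 330, 110)]), (6, 543, [(-1, 6, 341, 110), (1, 7, 440, 121)]),
    (6, 554, [(-1, 2, 550, 103), (-1, 6, 352, 110), (1, 7, 451, 121)]),
    (7, 512, [(-1, 4, 110, 330)]), (7, 523, [(-1, 4, 121, 330), (1, 5, 220, 341)]),
    (7, 554, [(-1, 4, 152, 330), (1, 5, 251, 341)])],
  [(0, 103, [(1, 2, 501, 220)]), (0, 114, [(1, 2, 512, 220)]), (1, 334, [(-1, 1, 330, 402),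
    (1, 3, 532, 440)]), (1, 352, [(1, 3, 550, 440)]), (2, 532, [(1, 1, 330, 0)]),
    (2, 543, [(1, 1, 341, 0)]), (2, 554, [(1, 0, 152, 0), (1, 1, 352, 0), (-1, 2, 550, 22),
    (-1, 3, 550, 42)]), (3, 4, [(1, 1, 303, 0), (-1, 4, 0, 11)]), (3, 11, [(-1, 0, 110, 0)]),
    (3, 22, [(-1, 0, 121, 0)]), (3, 53, [(-1, 0, 152, 0)]), (4, 103, [(-1, 3, 501, 341),
    (1, 5, 0, 330)]), (4, 114, [(1, 0, 110, 303), (-1, 3, 512, 341), (1, 5, 11, 330)]),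
    (5, 202, [(-1, 3, 501, 440)]), (5, 213, [(-1, 3, 512, 440)]), (5, 224, [(-1, 3, 523, 440),
    (1, 6, 220, 451)]), (6, 303, [(-1, 4, 0, 110)]), (6, 334, [(-1, 2, 532, 121),
    (-1, 4, 31, 110)]), (6, 352, [(-1, 2, 550, 121)]), (7, 433, [(-1, 2, 532, 220)]),
    (7, 444, [(1, 1, 341, 202), (-1, 2, 543, 220), (-1, 7, 440, 251)]),
    (7, 451, [(-1, 2, 550, 220)]), (8, 523, [(-1, 6, 220, 550)]), (8, 543, [(1, 1, 341, 501),
    (-1, 7, 440, 550)]), (8, 554, [(-1, 6, 251, 550)])],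
  [(0, 103, [(1, 0, 0, 0)]), (0, 114, [(1, 0, 11, 0), (1, 1, 110, 11)]),
    (1, 334, [(1, 0, 31, 0), (1, 3, 330, 31)]), (2, 523, [(1, 2, 220, 220)]),
    (2, 554, [(1, 2, 251, 220)]), (3, 543, [(1, 4, 440, 440)]), (3, 554, [(1, 4, 451, 440),
    (-1, 5, 550, 451)]), (4, 4, [(-1, 0, 0, 103), (1, 1, 103, 110)]),
    (4, 11, [(1, 1, 110, 110)]), (4, 22, [(1, 1, 121, 110)]), (4, 42, [(-1, 8, 440, 110)]),
    (4, 53, [(1, 1, 152, 110)]), (5, 4, [(-1, 3, 303, 330)]), (5, 22, [(1, 7, 220, 330)]),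
    (5, 31, [(-1, 3, 330, 330)]), (5, 42, [(-1, 3, 341, 330)]), (5, 53, [(-1, 3, 352, 330)]),
    (6, 202, [(-1, 6, 0, 550)]), (6, 213, [(-1, 6, 11, 550)]), (6, 224, [(1, 2, 220, 523),
    (1, 5, 523, 550)]), (7, 402, [(1, 0, 0, 501), (-1, 5, 501, 550), (-1, 6, 0, 550)]),
    (7, 433, [(1, 0, 31, 501), (1, 3, 330, 532), (-1, 5, 532, 550)]),
    (7, 444, [(-1, 4, 440, 543), (-1, 5, 543, 550)]), (7, 451, [(-1, 5, 550, 550)])],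
  [(0, 4, [(-1, 0, 0, 22), (-1, 1, 0, 42), (1, 5, 402, 0), (1, 6, 501, 11)]),
    (0, 22, [(1, 3, 220, 0)]), (0, 42, [(1, 5, 440, 0)]), (0, 53, [(1, 5, 451, 0),
    (1, 6, 550, 11)]), (1, 114, [(-1, 0, 11, 121), (-1, 2, 110, 152), (1, 6, 512, 110)]),
    (2, 202, [(1, 0, 0, 220)]), (2, 213, [(1, 0, 11, 220)]), (2, 224, [(1, 0, 22, 220),
    (1, 2, 121, 251), (-1, 3, 220, 202)]), (3, 334, [(-1, 1, 31, 341), (-1, 4, 330, 352),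
    (1, 7, 532, 330)]), (4, 402, [(1, 1, 0, 440)]), (4, 433, [(1, 1, 31, 440),
    (1, 4, 330, 451)]), (4, 444, [(1, 1, 42, 440), (1, 4, 341, 451), (-1, 5, 440, 402)]),
    (5, 512, [(-1, 2, 110, 550)]), (5, 554, [(-1, 2, 152, 550), (-1, 4, 352, 550),
    (1, 5, 451, 501), (1, 6, 550, 512)]), (6, 4, [(1, 4, 303, 550)]), (6, 22, [(-1, 2, 121, 550),
    (1, 3, 220, 501)]), (6, 31, [(1, 4, 330, 550)]), (6, 42, [(1, 4, 341, 550)]),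
    (6, 53, [(1, 4, 352, 550)]), (7, 202, [(-1, 1, 0, 341), (1, 7, 501, 330)]),
    (7, 213, [(-1, 2, 110, 352), (1, 7, 512, 330)]), (7, 224, [(1, 7, 523, 330)]),
    (7, 251, [(1, 7, 550, 330)]), (8, 402, [(-1, 0, 0, 121), (1, 6, 501, 110)]),
    (8, 433, [(1, 6, 532, 110)]), (8, 444, [(1, 6, 543, 110)]), (8, 451, [(1, 6, 550, 110)])],
  [(0, 4, [(1, 1, 303, 220)]), (0, 31, [(1, 1, 330, 220)]), (0, 42, [(1, 1, 341, 220)]),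
    (0, 53, [(1, 1, 352, 220)]), (1, 4, [(1, 0, 103, 440), (1, 3, 0, 451)]),
    (1, 11, [(1, 0, 110, 440)]), (1, 22, [(1, 0, 121, 440)]), (1, 53, [(1, 0, 152, 440)]),
    (2, 103, [(1, 3, 0, 550)]), (2, 114, [(-1, 0, 110, 543), (1, 3, 11, 550)]),
    (3, 202, [(1, 2, 501, 0)]), (3, 213, [(1, 2, 512, 0)]), (3, 224, [(1, 2, 523, 0),
    (-1, 4, 220, 11)]), (3, 251, [(1, 2, 550, 0)]), (4, 334, [(-1, 1, 330, 523),
    (-1, 2, 532, 501), (1, 3, 31, 550)]), (5, 433, [(-1, 2, 532, 0)]), (5, 444, [(-1, 2, 543, 0),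
    (-1, 5, 440, 31)]), (6, 523, [(-1, 4, 220, 110)]), (6, 554, [(1, 1, 352, 121),
    (-1, 2, 550, 103), (-1, 4, 251, 110)]), (7, 543, [(-1, 5, 440, 330)]),
    (7, 554, [(1, 0, 152, 341), (-1, 5, 451, 330)])],
  [(0, 114, [(-1, 2, 110, 440)]), (1, 334, [(-1, 4, 330, 220)]), (2, 554, [(-1, 6, 550, 0)]),
    (3, 4, [(-1, 0, 0, 512), (-1, 3, 202, 550)]), (3, 22, [(-1, 3, 220, 550)]),
    (3, 42, [(-1, 5, 440, 550)]), (3, 53, [(-1, 3, 251, 550)]), (4, 202, [(-1, 0, 0, 110)]),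
    (4, 213, [(-1, 0, 11, 110)]), (4, 224, [(-1, 0, 22, 110), (-1, 3, 220, 152)]),
    (5, 402, [(-1, 1, 0, 330)]), (5, 433, [(-1, 1, 31, 330)]), (5, 444, [(-1, 1, 42, 330),
    (-1, 5, 440, 352)])],
  [(0, 4, [(1, 0, 0, 103), (1, 3, 303, 110), (-1, 4, 402, 121), (1, 5, 501, 152)]),
    (0, 31, [(1, 3, 330, 110)]), (0, 42, [(1, 3, 341, 110), (-1, 4, 440, 121)]),
    (0, 53, [(1, 3, 352, 110), (-1, 4, 451, 121), (1, 5, 550, 152)]), (1, 4, [(1, 1, 103, 330),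
    (-1, 2, 202, 341)]), (1, 11, [(1, 1, 110, 330)]), (1, 22, [(1, 1, 121, 330),
    (-1, 2, 220, 341)]), (1, 53, [(1, 1, 152, 330), (-1, 2, 251, 341)]),
    (2, 103, [(1, 2, 202, 440)]), (2, 114, [(1, 0, 11, 402), (1, 1, 110, 433), (1, 2, 213, 440),
    (1, 5, 512, 451)]), (2, 121, [(1, 2, 220, 440)]), (2, 152, [(1, 2, 251, 440)]),
    (3, 213, [(1, 0, 11, 501), (1, 1, 110, 532), (1, 5, 512, 550)]), (3, 224, [(1, 0, 22, 501),
    (1, 1, 121, 532), (-1, 2, 220, 543), (1, 5, 523, 550)]), (4, 303, [(-1, 0, 0, 202),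
    (1, 4, 402, 220), (-1, 5, 501, 251)]), (4, 334, [(-1, 0, 31, 202), (1, 3, 330, 213),
    (1, 4, 433, 220), (-1, 5, 532, 251)]), (4, 341, [(1, 4, 440, 220)]),
    (4, 352, [(1, 4, 451, 220), (-1, 5, 550, 251)]), (5, 402, [(-1, 0, 0, 501),
    (-1, 5, 501, 550)]), (5, 433, [(-1, 0, 31, 501), (1, 3, 330, 512), (-1, 5, 532, 550)]),
    (5, 444, [(-1, 0, 42, 501), (1, 3, 341, 512), (-1, 4, 440, 523), (-1, 5, 543, 550)]),
    (5, 451, [(-1, 5, 550, 550)]), (6, 501, [(1, 0, 0, 0)]), (6, 512, [(1, 0, 11, 0),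
    (1, 1, 110, 31)]), (6, 523, [(1, 0, 22, 0), (1, 1, 121, 31), (-1, 2, 220, 42)]),
    (6, 532, [(1, 0, 31, 0), (-1, 3, 330, 11)]), (6, 543, [(1, 0, 42, 0), (-1, 3, 341, 11),
    (1, 4, 440, 22)]), (6, 554, [(1, 0, 53, 0), (1, 1, 152, 31), (-1, 2, 251, 42),
    (-1, 3, 352, 11), (1, 4, 451, 22), (-1, 5, 550, 53)])],
  [(0, 4, [(-1, 0, 0, 0)]), (1, 114, [(-1, 1, 110, 330)]), (2, 224, [(1, 2, 220, 440)]),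
    (3, 334, [(1, 3, 330, 110)]), (4, 444, [(-1, 4, 440, 220)]), (5, 554, [(1, 5, 550, 550)])]]

/-- The involution of the quiver exchanging the arrows `α` and `β`, on vertices. -/
def swapVertex (i : ℕ) : ℕ :=
  if i = 1 then 3 else if i = 2 then 4 else if i = 3 then 1 else if i = 4 then 2 else i

/-- The action of the involution on codes of paths. -/
def swapCode (c : ℕ) : ℕ :=
  swapVertex (c / 100) * 100 + swapVertex (c / 10 % 10) * 10 + c % 10

/-- The parity sign of the number of arrows `γ` in a path. -/
def gammaSign (c : ℕ) : ℤ :=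
  if c % 10 = 0 ∨ c / 100 = 0 ∧ c % 10 < 4 ∨ (c / 100 = 1 ∨ c / 100 = 3) ∧ c % 10 < 3 ∨
    (c / 100 = 2 ∨ c / 100 = 4) ∧ c % 10 < 2 then 1 else -1

/-- The twist of the right component of a term by the automorphism of `R_1` exchanging `α` and `β`
and changing the sign of `γ`. -/
def twist (t : Term) : Term := (gammaSign t.2.2.2 * t.1, t.2.1, t.2.2.1, swapCode t.2.2.2)

/-- The code of the vertex at the left end of the `k`-th summand in degree `n`. -/
def lft (n k : ℕ) : ℕ :=
  match (vertexTable.getD (n % 11) [])[k]? with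
  | some v => 110 * v.1
  | none => 999

/-- The code of the vertex at the right end of the `k`-th summand in degree `n`. -/
def rgt (n k : ℕ) : ℕ :=
  match (vertexTable.getD (n % 11) [])[k]? with
  | some v => 110 * if n % 22 < 11 then v.2 else swapVertex v.2
  | none => 999

/-- The value of the differential from degree `n + 1` to degree `n` on the `k`-th generator. -/
def diff (n k : ℕ) : List Term :=
  let l := (diffTable.getD (n % 11) []).getD k []
  if n % 22 < 11 then l else l.map twist

/-- The value of the homotopy in degree `n` on the `k`-th generator multiplied by `p`. -/
def homot (n k p : ℕ) : List Term :=
  match (homotopyTable.getD (n % 11) []).find? fun e => Nat.beq e.1 k && Nat.beq e.2.1 p with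
  | some e => if n % 22 < 11 then e.2.2 else e.2.2.map twist
  | none => []

/-- A presentation of a `K`-algebra `R` with a basis of paths multiplying like the paths of `R_1`,
together with its enveloping algebra `Λ` acting on `R`. -/
structure PathAlg (K R Λ : Type u) [Field K] [Ring R] [Algebra K R] [Ring Λ] [Algebra K Λ]
    [Module Λ R] where
  /-- The class of a path with given code. -/
  pth : ℕ → R
  /-- The basis of paths. -/
  basis : Module.Basis Pth K R
  basis_apply : ∀ c : Pth, basis c = pth c
  pth_mul : ∀ x y, pth x * pth y = pth (mulc x y)
  pth_eq_zero : ∀ c, c ∉ paths → pth c = 0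
  sum_pth : ∑ i : Fin 6, pth (110 * i.val) = 1
  /-- The pure tensors in the enveloping algebra. -/
  pure : R →ₗ[K] R →ₗ[K] Λ
  pure_one : pure 1 1 = 1
  pure_mul : ∀ a b a' b', pure a b * pure a' b' = pure (a * a') (b' * b)
  /-- The linear map on the enveloping algebra given by a bilinear map. -/
  lift : ∀ {M : Type u} [AddCommGroup M] [Module K M], (R →ₗ[K] R →ₗ[K] M) → Λ →ₗ[K] M
  lift_pure : ∀ {M : Type u} [AddCommGroup M] [Module K M] (f : R →ₗ[K] R →ₗ[K] M) (a b : R),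
    lift f (pure a b) = f a b
  induction : ∀ (p : Λ → Prop), (∀ a b, p (pure a b)) → (∀ x y, p x → p y → p (x + y)) → ∀ x, p x
  pure_smul : ∀ a b r, pure a b • r = a * r * b

section Resolution

variable {K} {R Λ : Type u} [Ring R] [Algebra K R] [Ring Λ] [Algebra K Λ] [Module Λ R]
  (A : PathAlg K R Λ)

theorem PathAlg.pth_junk : A.pth 999 = 0 := A.pth_eq_zero _ (by decide)

/-- The pure tensor `p ⊗ q` in the enveloping algebra. -/
noncomputable def tens (p q : ℕ) : Λ := A.pure (A.pth p) (A.pth q)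

theorem tens_mul (p q p' q' : ℕ) :
    tens A p q * tens A p' q' = tens A (mulc p p') (mulc q' q) := by
  rw [tens, tens, tens, A.pure_mul, A.pth_mul, A.pth_mul]

/-- The ambient free module over the enveloping algebra. -/
abbrev FreeMod (Λ : Type u) [Ring Λ] : Type u := ℕ →₀ Λ

/-- The element of the free module represented by a term. -/
noncomputable def evTerm (t : Term) : FreeMod Λ :=
  (t.1 : K) • Finsupp.single t.2.1 (tens A t.2.2.1 t.2.2.2)

/-- The element of the free module represented by a list of terms. -/
noncomputable def ev (l : List Term) : FreeMod Λ := (l.map (evTerm A)).sum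

theorem ev_nil : ev A [] = 0 := rfl

theorem ev_cons (t : Term) (l : List Term) : ev A (t :: l) = evTerm A t + ev A l := by
  rw [ev, List.map_cons, List.sum_cons]; rfl

theorem ev_append (l l' : List Term) : ev A (l ++ l') = ev A l + ev A l' := by
  rw [ev, List.map_append, List.sum_append]; rfl

theorem ev_flatMap (l : List Term) (f : Term → List Term) :
    ev A (l.flatMap f) = (l.map fun t => ev A (f t)).sum := by
  induction l with
  | nil => rfl
  | cons t l ih => rw [List.flatMap_cons, ev_append, ih, List.map_cons, List.sum_cons]

/-- A map given by lists on terms, compared with a linear map. -/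
theorem map_ev {M : Type*} [AddCommGroup M] [Module K M] (f : FreeMod Λ →ₗ[K] M)
    (l : List Term) : f (ev A l) = (l.map fun t => f (evTerm A t)).sum := by
  rw [ev, map_list_sum, List.map_map]; rfl

/-- The total coefficient of a basis element in a list of terms. -/
def coeffOf (m : ℕ × ℕ × ℕ) : List Term → ℤ
  | [] => 0
  | t :: l => if t.2 == m then t.1 + coeffOf m l else coeffOf m l

theorem ev_eq_coeffOf (m : ℕ × ℕ × ℕ) (l : List Term) :
    ev A l = evTerm A (coeffOf m l, m) + ev A (l.filter fun t => !(t.2 == m)) := by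
  induction l with
  | nil => simp [ev_nil, coeffOf, evTerm]
  | cons t l ih =>
    rw [ev_cons, ih, coeffOf]
    by_cases h : t.2 = m
    · subst h
      simp only [beq_self_eq_true, ↓reduceIte, Bool.not_true, Bool.false_eq_true,
        not_false_eq_true, List.filter_cons_of_neg]
      simp only [evTerm, Int.cast_add, add_smul]
      abel
    · rw [if_neg (by simpa using h), List.filter_cons_of_pos (by simpa using h), ev_cons]
      abel

/-- A test for a list of terms to represent zero; the first argument bounds the recursion. -/
def isZeroAux : ℕ → List Term → Bool
  | _, [] => true
  | 0, _ :: _ => false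
  | n + 1, t :: l => (t.1 + coeffOf t.2 l == 0) && isZeroAux n (l.filter fun t' => !(t'.2 == t.2))

theorem ev_eq_zero_of_isZeroAux (n : ℕ) (l : List Term) (h : isZeroAux n l = true) :
    ev A l = 0 := by
  induction n generalizing l with
  | zero =>
    cases l with
    | nil => rfl
    | cons t l => simp [isZeroAux] at h
  | succ n ih =>
    cases l with
    | nil => rfl
    | cons t l =>
      simp only [isZeroAux, Bool.and_eq_true, beq_iff_eq] at h
      rw [ev_eq_coeffOf A t.2, List.filter_cons_of_neg (by simp), ih _ h.2, coeffOf,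
        if_pos (by simp), h.1, evTerm, Int.cast_zero, zero_smul, add_zero]

/-- A test for a list of terms to represent zero. -/
def isZero (l : List Term) : Bool :=
  let l' := l.filter fun t => !(t.2.2.1 == 999 || t.2.2.2 == 999)
  isZeroAux l'.length l'

theorem tens_junk {p q : ℕ} (h : p = 999 ∨ q = 999) : tens A p q = 0 := by
  rcases h with rfl | rfl
  · rw [tens, A.pth_junk, map_zero, LinearMap.zero_apply]
  · rw [tens, A.pth_junk, map_zero]

theorem ev_eq_zero (l : List Term) (h : isZero l = true) : ev A l = 0 := by
  rw [← ev_eq_zero_of_isZeroAux A _ _ h]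
  clear h
  induction l with
  | nil => rfl
  | cons t l ih =>
    rw [ev_cons, ih]
    by_cases h : t.2.2.1 = 999 ∨ t.2.2.2 = 999
    · rw [List.filter_cons_of_neg (by simpa using fun h' => h.resolve_left h'), evTerm, tens_junk A h, Finsupp.single_zero,
        smul_zero, zero_add]
    · rw [List.filter_cons_of_pos (by simpa using h), ev_cons]

/-- The opposite of a list of terms. -/
def negL (l : List Term) : List Term := l.map fun t => (-t.1, t.2)

theorem ev_negL (l : List Term) : ev A (negL l) = -ev A l := by
  induction l with
  | nil => simp [negL, ev_nil]
  | cons t l ih =>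
    rw [negL, List.map_cons, ev_cons, ← negL, ih, ev_cons, neg_add, evTerm, evTerm, Int.cast_neg,
      neg_smul]

theorem ev_eq_of_isZero (l l' : List Term) (h : isZero (l ++ negL l') = true) :
    ev A l = ev A l' := by
  have := ev_eq_zero A _ h
  rwa [ev_append, ev_negL, add_neg_eq_zero] at this

/-- The image of a list of terms under the bimodule map given by `f` on generators. -/
def bimodL (f : ℕ → List Term) (l : List Term) : List Term :=
  l.flatMap fun t => (f t.2.1).map fun t' =>
    (t.1 * t'.1, t'.2.1, mulc t.2.2.1 t'.2.2.1, mulc t'.2.2.2 t.2.2.2)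

/-- The bimodule map given by lists of terms on generators. -/
noncomputable def bimod (f : ℕ → List Term) : FreeMod Λ →ₗ[Λ] FreeMod Λ :=
  Finsupp.linearCombination (Λ) fun k => ev A (f k)

theorem bimod_single (f : ℕ → List Term) (k : ℕ) (a : Λ) :
    bimod A f (Finsupp.single k a) = a • ev A (f k) :=
  Finsupp.linearCombination_single _ _ _

theorem tens_smul_ev (p q : ℕ) (l : List Term) :
    tens A p q • ev A l =
      ev A (l.map fun t' => (t'.1, t'.2.1, mulc p t'.2.2.1, mulc t'.2.2.2 q)) := by
  induction l with
  | nil => rw [ev_nil, List.map_nil, ev_nil, smul_zero]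
  | cons t l ih =>
    rw [ev_cons, smul_add, ih, List.map_cons, ev_cons, evTerm, evTerm, smul_comm,
      Finsupp.smul_single, smul_eq_mul, tens_mul]

theorem smul_ev (c : ℤ) (l : List Term) :
    (c : K) • ev A l = ev A (l.map fun t' => (c * t'.1, t'.2)) := by
  induction l with
  | nil => rw [ev_nil, List.map_nil, ev_nil, smul_zero]
  | cons t l ih =>
    rw [ev_cons, smul_add, ih, List.map_cons, ev_cons, evTerm, evTerm, Int.cast_mul, mul_smul]

theorem bimod_ev (f : ℕ → List Term) (l : List Term) :
    bimod A f (ev A l) = ev A (bimodL f l) := by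
  rw [bimodL, ev_flatMap]
  refine (map_ev A ((bimod A f).restrictScalars K) l).trans ?_
  congr 1
  refine List.map_congr_left fun t _ => ?_
  change bimod A f (evTerm A t) = _
  rw [evTerm, LinearMap.map_smul_of_tower, bimod_single, tens_smul_ev, smul_ev, List.map_map]
  rfl

theorem ev_singleton (k p q : ℕ) : ev A [(1, k, p, q)] = Finsupp.single k (tens A p q) := by
  rw [ev_cons, ev_nil, add_zero, evTerm, Int.cast_one, one_smul]

/-- The image of a list of terms under the right linear map given by `f`. -/
def rightL (f : ℕ → ℕ → List Term) (l : List Term) : List Term :=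
  l.flatMap fun t => if isPath t.2.2.1 then (f t.2.1 t.2.2.1).map fun t' =>
    (t.1 * t'.1, t'.2.1, t'.2.2.1, mulc t'.2.2.2 t.2.2.2) else []

/-- The restriction to the `k`-th summand and to `R ⊗ 1` of the right linear map given by `f`. -/
noncomputable def rightAux (f : ℕ → ℕ → List Term) (k : ℕ) : R →ₗ[K] FreeMod Λ :=
  A.basis.constr K fun c : Pth => ev A (f k c)

theorem rightAux_pth (f : ℕ → ℕ → List Term) (k : ℕ) {p : ℕ} (hp : p ∈ paths) :
    rightAux A f k (A.pth p) = ev A (f k p) := by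
  have := A.basis.constr_basis K (fun c : Pth => ev A (f k c)) ⟨p, hp⟩
  rwa [A.basis_apply] at this

/-- The bilinear map underlying `rightMap`. -/
noncomputable def rightBilin (f : ℕ → ℕ → List Term) (k : ℕ) : R →ₗ[K] R →ₗ[K] FreeMod Λ :=
  LinearMap.mk₂ K (fun x y => A.pure 1 y • rightAux A f k x)
    (fun x x' y => by rw [map_add, smul_add])
    (fun c x y => by rw [map_smul, smul_comm])
    (fun x y y' => by rw [map_add, add_smul])
    (fun c x y => by rw [map_smul, smul_assoc])

/-- The right linear map given by lists of terms on generators multiplied by paths. -/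
noncomputable def rightMap (f : ℕ → ℕ → List Term) : FreeMod Λ →ₗ[K] FreeMod Λ :=
  Finsupp.lsum K fun k => A.lift (rightBilin A f k)

theorem rightMap_single_pure (f : ℕ → ℕ → List Term) (k : ℕ) (x y : R) :
    rightMap A f (Finsupp.single k (A.pure x y)) = A.pure 1 y • rightAux A f k x := by
  rw [rightMap, Finsupp.lsum_single, A.lift_pure]
  rfl

theorem freeMod_induction {P : FreeMod Λ → Prop} (h0 : P 0)
    (h1 : ∀ k a b, P (Finsupp.single k (A.pure a b))) (h2 : ∀ x y, P x → P y → P (x + y)) (z) :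
    P z := by
  induction z using Finsupp.induction_linear with
  | zero => exact h0
  | add x y hx hy => exact h2 x y hx hy
  | single k a =>
    refine A.induction (fun a => P (Finsupp.single k a)) (fun a b => h1 k a b)
      (fun x y hx hy => ?_) a
    rw [Finsupp.single_add]
    exact h2 _ _ hx hy

theorem pure_one_mul (x y r : R) : A.pure 1 r * A.pure x y = A.pure x (y * r) := by
  rw [A.pure_mul, one_mul]

theorem rightMap_smul (f : ℕ → ℕ → List Term) (r : R) (z : FreeMod Λ) :
    rightMap A f (A.pure 1 r • z) = A.pure 1 r • rightMap A f z := by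
  induction z using freeMod_induction A with
  | h0 => simp only [smul_zero, map_zero]
  | h1 k a b =>
    rw [Finsupp.smul_single, smul_eq_mul, pure_one_mul, rightMap_single_pure, rightMap_single_pure,
      ← mul_smul, pure_one_mul]
  | h2 x y hx hy => rw [smul_add, map_add, map_add, smul_add, hx, hy]

theorem pure_one_smul_ev (q : ℕ) (l : List Term) :
    A.pure 1 (A.pth q) • ev A l =
      ev A (l.map fun t' => (t'.1, t'.2.1, t'.2.2.1, mulc t'.2.2.2 q)) := by
  induction l with
  | nil => rw [ev_nil, List.map_nil, ev_nil, smul_zero]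
  | cons t l ih =>
    rw [ev_cons, smul_add, ih, List.map_cons, ev_cons, evTerm, evTerm, smul_comm,
      Finsupp.smul_single, smul_eq_mul, tens, pure_one_mul, A.pth_mul, ← tens]

theorem rightMap_ev (f : ℕ → ℕ → List Term) (l : List Term) :
    rightMap A f (ev A l) = ev A (rightL f l) := by
  rw [rightL, ev_flatMap, map_ev]
  congr 1
  refine List.map_congr_left fun t _ => ?_
  rw [evTerm, map_smul, tens, rightMap_single_pure]
  split_ifs with h
  · rw [rightAux_pth A f _ (isPath_iff.1 h), pure_one_smul_ev, smul_ev, List.map_map]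
    rfl
  · rw [A.pth_eq_zero t.2.2.1 (by rwa [isPath_iff] at h), map_zero, smul_zero, smul_zero, ev_nil]

/-- The augmentation of the resolution. -/
noncomputable def aug : FreeMod Λ →ₗ[Λ] R :=
  Finsupp.linearCombination Λ fun k => A.pth (lft 0 k)

theorem aug_single_pure (k : ℕ) (x y : R) :
    aug A (Finsupp.single k (A.pure x y)) = x * A.pth (lft 0 k) * y := by
  rw [aug, Finsupp.linearCombination_single, A.pure_smul]

/-- The splitting of the augmentation. -/
noncomputable def split : R →ₗ[K] FreeMod Λ :=
  ∑ i : Fin 6, (Finsupp.lsingle i.val).comp ((A.pure (A.pth (110 * i.val))).comp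
    (LinearMap.mulLeft K (A.pth (110 * i.val))))

theorem split_apply (r : R) : split A r =
    ∑ i : Fin 6, Finsupp.single i.val (A.pure (A.pth (110 * i.val)) (A.pth (110 * i.val) * r)) := by
  rw [split, LinearMap.sum_apply]
  rfl

theorem split_mul (x r : R) : split A (x * r) = A.pure 1 r • split A x := by
  rw [split_apply, split_apply, Finset.smul_sum]
  refine Finset.sum_congr rfl fun i _ => ?_
  rw [Finsupp.smul_single, smul_eq_mul, pure_one_mul, mul_assoc]

theorem aug_split (r : R) : aug A (split A r) = r := by
  rw [split_apply, map_sum]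
  refine Eq.trans (Finset.sum_congr rfl fun i _ => ?_) (b := ∑ i : Fin 6, A.pth (110 * i.val) * r) ?_
  · have h : ∀ i : Fin 6, lft 0 i.val = 110 * i.val ∧
        mulc (110 * i.val) (110 * i.val) = 110 * i.val := by decide
    rw [aug_single_pure, (h i).1, ← mul_assoc, A.pth_mul, (h i).2, A.pth_mul, (h i).2]
  · rw [← Finset.sum_mul, A.sum_pth, one_mul]

/-- The image of a list of terms under the augmentation followed by its splitting. -/
def augL (l : List Term) : List Term :=
  l.flatMap fun t => (List.finRange 6).map fun i => (t.1, i.val, 110 * i.val,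
    mulc (110 * i.val) (mulc (mulc t.2.2.1 (lft 0 t.2.1)) t.2.2.2))

theorem split_pth (m : ℕ) : split A (A.pth m) = ev A ((List.finRange 6).map fun i =>
    ((1 : ℤ), i.val, 110 * i.val, mulc (110 * i.val) m)) := by
  rw [split_apply, Fin.sum_univ_def, ev, List.map_map]
  congr 1
  refine List.map_congr_left fun i _ => ?_
  rw [A.pth_mul, ← tens, Function.comp_apply, evTerm, Int.cast_one, one_smul]

theorem split_aug_ev [IsScalarTower K Λ R] (l : List Term) :
    split A (aug A (ev A l)) = ev A (augL l) := by
  rw [augL, ev_flatMap]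
  refine (map_ev A ((split A).comp ((aug A).restrictScalars K)) l).trans ?_
  congr 1
  refine List.map_congr_left fun t _ => ?_
  rw [evTerm, map_smul, LinearMap.comp_apply, LinearMap.restrictScalars_apply, tens,
    aug_single_pure, A.pth_mul, A.pth_mul, split_pth, smul_ev, List.map_map]
  simp only [Function.comp_def, mul_one]

/-- The generator of the `k`-th summand in degree `n`, multiplied by `p`. -/
def gen (n k p : ℕ) : List Term := [(1, k, mulc p (lft n k), rgt n k)]

/-- The generator of the `k`-th summand in degree `n`. -/
def idem (n k : ℕ) : List Term := [(1, k, lft n k, rgt n k)]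

theorem eq_of_generators (T : FreeMod Λ →ₗ[K] FreeMod Λ) (n : ℕ)
    (hT : ∀ r z, T (A.pure 1 r • z) = A.pure 1 r • T z)
    (h : ∀ k, ∀ p ∈ paths, T (ev A (gen n k p)) = ev A (gen n k p)) (z : FreeMod Λ) :
    T (bimod A (idem n) z) = bimod A (idem n) z := by
  induction z using freeMod_induction A with
  | h0 => simp only [map_zero]
  | h1 k x y =>
    let f : R →ₗ[K] FreeMod Λ := ((bimod A (idem n)).restrictScalars K).comp
      ((Finsupp.lsingle k).comp (A.pure.flip y))
    have hf : T.comp f = f := by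
      refine A.basis.ext fun c => ?_
      have : f (A.basis c) = A.pure 1 y • ev A (gen n k c) := by
        rw [A.basis_apply]
        change bimod A (idem n) (Finsupp.single k (A.pure (A.pth c) y)) = _
        rw [bimod_single, idem, gen, ev_singleton, ev_singleton, Finsupp.smul_single,
          Finsupp.smul_single, smul_eq_mul, smul_eq_mul, tens, tens, pure_one_mul, A.pure_mul,
          A.pth_mul]
      rw [LinearMap.comp_apply, this, hT, h k c c.2]
    exact LinearMap.congr_fun hf x
  | h2 x y hx hy => rw [map_add, map_add, hx, hy]

theorem lft_add (n k : ℕ) : lft (n + 22) k = lft n k := by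
  rw [lft, lft, show (n + 22) % 11 = n % 11 by lia]

theorem rgt_add (n k : ℕ) : rgt (n + 22) k = rgt n k := by
  rw [rgt, rgt, show (n + 22) % 11 = n % 11 by lia, Nat.add_mod_right]

theorem diff_add (n k : ℕ) : diff (n + 22) k = diff n k := by
  rw [diff, diff, show (n + 22) % 11 = n % 11 by lia, Nat.add_mod_right]

theorem homot_add (n k p : ℕ) : homot (n + 22) k p = homot n k p := by
  rw [homot, homot, show (n + 22) % 11 = n % 11 by lia, Nat.add_mod_right]

theorem of_periodic (P : ℕ → Prop) (hP : ∀ n, P n → P (n + 22)) (h : ∀ n < 22, P n) (n : ℕ) :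
    P n := by
  induction n using Nat.strong_induction_on with
  | _ n ih =>
    by_cases hn : n < 22
    · exact h n hn
    · obtain ⟨m, rfl⟩ : ∃ m, n = m + 22 := ⟨n - 22, by lia⟩
      exact hP m (ih m (by lia))

theorem lft_eq_junk (n : ℕ) {k : ℕ} (hk : 9 ≤ k) : lft n k = 999 := by
  have h : ∀ m < 11, (vertexTable.getD m []).length ≤ 9 := by decide
  rw [lft, List.getElem?_eq_none ((h _ (Nat.mod_lt n (by decide))).trans hk)]

theorem rgt_eq_junk (n : ℕ) {k : ℕ} (hk : 9 ≤ k) : rgt n k = 999 := by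
  have h : ∀ m < 11, (vertexTable.getD m []).length ≤ 9 := by decide
  rw [rgt, List.getElem?_eq_none ((h _ (Nat.mod_lt n (by decide))).trans hk)]

theorem diff_eq_nil (n : ℕ) {k : ℕ} (hk : 9 ≤ k) : diff n k = [] := by
  have h : ∀ m < 11, (diffTable.getD m []).length ≤ 9 := by decide +kernel
  rw [diff, List.getD_eq_default _ _ ((h _ (Nat.mod_lt n (by decide))).trans hk)]
  simp

/-- A test for the differential to be normalized by the idempotents of its target and source. -/
def checkIdem (n k : ℕ) : Bool :=
  isZero (bimodL (idem n) (diff n k) ++ negL (diff n k)) &&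
  isZero (bimodL (diff n) (idem (n + 1) k) ++ negL (diff n k)) &&
  isZero (bimodL (idem n) (idem n k) ++ negL (idem n k))

/-- A test for the composite of two differentials to vanish. -/
def checkComp (n k : ℕ) : Bool := isZero (bimodL (diff n) (diff (n + 1) k))

/-- A test for the homotopy identity in positive degree. -/
def checkHomot (n k : ℕ) : Bool :=
  paths.all fun p => isZero (bimodL (diff (n + 1)) (rightL (homot (n + 1)) (gen (n + 1) k p)) ++
    rightL (homot n) (bimodL (diff n) (gen (n + 1) k p)) ++ negL (gen (n + 1) k p))

/-- A test for the homotopy identity in degree zero, and for the vanishing of the composite of the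
differential and the augmentation. -/
def checkAug (k : ℕ) : Bool :=
  isZero (augL (diff 0 k)) && paths.all fun p =>
    isZero (bimodL (diff 0) (rightL (homot 0) (gen 0 k p)) ++ augL (gen 0 k p) ++
      negL (gen 0 k p))

theorem checkIdem_of_lt : ∀ n < 22, ∀ k < 9, checkIdem n k = true := by decide +kernel

theorem checkComp_of_lt : ∀ n < 22, ∀ k < 9, checkComp n k = true := by decide +kernel

theorem checkHomot_of_lt : ∀ n < 22, ∀ k < 9, checkHomot n k = true := by decide +kernel

theorem checkAug_of_lt : ∀ k < 9, checkAug k = true := by decide +kernel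

theorem idem_add (n : ℕ) : idem (n + 22) = idem n := by
  funext k; rw [idem, idem, lft_add, rgt_add]

theorem gen_add (n : ℕ) : gen (n + 22) = gen n := by
  funext k p; rw [gen, gen, lft_add, rgt_add]

theorem diff_add' (n : ℕ) : diff (n + 22) = diff n := funext fun k => diff_add n k

theorem homot_add' (n : ℕ) : homot (n + 22) = homot n :=
  funext fun k => funext fun p => homot_add n k p

theorem checkIdem_eq_true (n : ℕ) {k : ℕ} (hk : k < 9) : checkIdem n k = true := by
  refine of_periodic (fun n => checkIdem n k = true) (fun n h => ?_)
    (fun n hn => checkIdem_of_lt n hn k hk) n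
  rw [checkIdem, add_right_comm, idem_add, idem_add, diff_add']
  exact h

theorem checkComp_eq_true (n : ℕ) {k : ℕ} (hk : k < 9) : checkComp n k = true := by
  refine of_periodic (fun n => checkComp n k = true) (fun n h => ?_)
    (fun n hn => checkComp_of_lt n hn k hk) n
  rw [checkComp, add_right_comm, diff_add', diff_add']
  exact h

theorem checkHomot_eq_true (n : ℕ) {k : ℕ} (hk : k < 9) : checkHomot n k = true := by
  refine of_periodic (fun n => checkHomot n k = true) (fun n h => ?_)
    (fun n hn => checkHomot_of_lt n hn k hk) n
  rw [checkHomot, add_right_comm, diff_add', diff_add', homot_add', homot_add', gen_add]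
  exact h

theorem ev_term_junk (c : ℤ) (k p q : ℕ) (h : p = 999 ∨ q = 999) : ev A [(c, k, p, q)] = 0 := by
  rw [ev_cons, ev_nil, add_zero, evTerm, tens_junk A h, Finsupp.single_zero, smul_zero]

theorem ev_idem_junk (n : ℕ) {k : ℕ} (hk : 9 ≤ k) : ev A (idem n k) = 0 :=
  ev_term_junk A _ _ _ _ (Or.inl (lft_eq_junk n hk))

theorem ev_gen_junk (n : ℕ) {k : ℕ} (hk : 9 ≤ k) (p : ℕ) : ev A (gen n k p) = 0 :=
  ev_term_junk A _ _ _ _ (Or.inr (rgt_eq_junk n hk))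

/-- The idempotent endomorphism of the free module whose image is the term of degree `n` of the
resolution. -/
noncomputable abbrev proj (n : ℕ) : FreeMod Λ →ₗ[Λ] FreeMod Λ := bimod A (idem n)

/-- The differential on the free modules. -/
noncomputable abbrev dif (n : ℕ) : FreeMod Λ →ₗ[Λ] FreeMod Λ := bimod A (diff n)

theorem bimod_ext {M : Type*} [AddCommGroup M] [Module Λ M] {f g : FreeMod Λ →ₗ[Λ] M}
    (h : ∀ k, f (Finsupp.single k 1) = g (Finsupp.single k 1)) (z) : f z = g z :=
  LinearMap.congr_fun (Finsupp.lhom_ext' fun k => LinearMap.ext_ring (h k)) z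

theorem bimod_bimod_single (f g : ℕ → List Term) (k : ℕ) :
    bimod A f (bimod A g (Finsupp.single k 1)) = bimod A f (ev A (g k)) := by
  rw [bimod_single, one_smul]

theorem proj_proj (n : ℕ) (z) : proj A n (proj A n z) = proj A n z := by
  rw [← LinearMap.comp_apply]
  refine bimod_ext (f := (proj A n).comp (proj A n)) (g := proj A n) (fun k => ?_) z
  rw [LinearMap.comp_apply, bimod_bimod_single, bimod_single, one_smul]
  by_cases hk : k < 9
  · have := checkIdem_eq_true n hk
    rw [checkIdem, Bool.and_eq_true] at this
    rw [bimod_ev, ev_eq_of_isZero A _ _ this.2]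
  · rw [ev_idem_junk A n (not_lt.1 hk), map_zero]

theorem proj_dif (n : ℕ) (z) : proj A n (dif A n z) = dif A n z := by
  rw [← LinearMap.comp_apply]
  refine bimod_ext (f := (proj A n).comp (dif A n)) (g := dif A n) (fun k => ?_) z
  rw [LinearMap.comp_apply, bimod_bimod_single, bimod_single, one_smul]
  by_cases hk : k < 9
  · have := checkIdem_eq_true n hk
    simp only [checkIdem, Bool.and_eq_true] at this
    rw [bimod_ev, ev_eq_of_isZero A _ _ this.1.1]
  · rw [diff_eq_nil n (not_lt.1 hk), ev_nil, map_zero]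

theorem dif_proj (n : ℕ) (z) : dif A n (proj A (n + 1) z) = dif A n z := by
  rw [← LinearMap.comp_apply]
  refine bimod_ext (f := (dif A n).comp (proj A (n + 1))) (g := dif A n) (fun k => ?_) z
  rw [LinearMap.comp_apply, bimod_bimod_single, bimod_single, one_smul]
  by_cases hk : k < 9
  · have := checkIdem_eq_true n hk
    simp only [checkIdem, Bool.and_eq_true] at this
    rw [bimod_ev, ev_eq_of_isZero A _ _ this.1.2]
  · rw [diff_eq_nil n (not_lt.1 hk), ev_nil, ev_idem_junk A _ (not_lt.1 hk), map_zero]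

theorem dif_dif (n : ℕ) (z) : dif A n (dif A (n + 1) z) = 0 := by
  rw [← LinearMap.comp_apply]
  refine bimod_ext (f := (dif A n).comp (dif A (n + 1))) (g := 0) (fun k => ?_) z
  rw [LinearMap.comp_apply, bimod_bimod_single, LinearMap.zero_apply]
  by_cases hk : k < 9
  · rw [bimod_ev, ev_eq_zero A _ (checkComp_eq_true n hk)]
  · rw [diff_eq_nil _ (not_lt.1 hk), ev_nil, map_zero]

theorem aug_dif [IsScalarTower K Λ R] (z) : aug A (dif A 0 z) = 0 := by
  rw [← LinearMap.comp_apply]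
  refine bimod_ext (f := (aug A).comp (dif A 0)) (g := 0) (fun k => ?_) z
  rw [LinearMap.comp_apply, LinearMap.zero_apply, bimod_single, one_smul]
  by_cases hk : k < 9
  · have := checkAug_of_lt k hk
    rw [checkAug, Bool.and_eq_true] at this
    rw [← aug_split A (aug A _), split_aug_ev, ev_eq_zero A _ this.1, map_zero]
  · rw [diff_eq_nil _ (not_lt.1 hk), ev_nil, map_zero]

theorem homotopy_succ (n : ℕ) (z : FreeMod Λ) :
    dif A (n + 1) (rightMap A (homot (n + 1)) (proj A (n + 1) z)) +
      rightMap A (homot n) (dif A n (proj A (n + 1) z)) = proj A (n + 1) z := by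
  refine eq_of_generators A (((dif A (n + 1)).restrictScalars K).comp
    (rightMap A (homot (n + 1))) + (rightMap A (homot n)).comp ((dif A n).restrictScalars K))
    (n + 1) (fun r z => ?_) (fun k p hp => ?_) z
  · simp only [LinearMap.add_apply, LinearMap.comp_apply, LinearMap.restrictScalars_apply,
      map_smul, rightMap_smul, smul_add]
  · simp only [LinearMap.add_apply, LinearMap.comp_apply, LinearMap.restrictScalars_apply]
    by_cases hk : k < 9
    · have := checkHomot_eq_true n hk
      rw [checkHomot, List.all_eq_true] at this
      rw [rightMap_ev, bimod_ev, bimod_ev, rightMap_ev, ← ev_append]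
      exact ev_eq_of_isZero A _ _ (this p hp)
    · simp only [ev_gen_junk A _ (not_lt.1 hk), map_zero, add_zero]

theorem homotopy_zero [IsScalarTower K Λ R] (z : FreeMod Λ) :
    dif A 0 (rightMap A (homot 0) (proj A 0 z)) + split A (aug A (proj A 0 z)) = proj A 0 z := by
  refine eq_of_generators A (((dif A 0).restrictScalars K).comp
    (rightMap A (homot 0)) + (split A).comp ((aug A).restrictScalars K))
    0 (fun r z => ?_) (fun k p hp => ?_) z
  · simp only [LinearMap.add_apply, LinearMap.comp_apply, LinearMap.restrictScalars_apply,
      map_smul, rightMap_smul, smul_add, A.pure_smul, one_mul, split_mul]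
  · simp only [LinearMap.add_apply, LinearMap.comp_apply, LinearMap.restrictScalars_apply]
    by_cases hk : k < 9
    · have := checkAug_of_lt k hk
      rw [checkAug, Bool.and_eq_true, List.all_eq_true] at this
      rw [rightMap_ev, bimod_ev, split_aug_ev, ← ev_append]
      exact ev_eq_of_isZero A _ _ (this.2 p hp)
    · simp only [ev_gen_junk A _ (not_lt.1 hk), map_zero, add_zero]

theorem aug_proj [IsScalarTower K Λ R] (z) : aug A (proj A 0 z) = aug A z := by
  rw [← LinearMap.comp_apply]
  refine bimod_ext (f := (aug A).comp (proj A 0)) (fun k => ?_) z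
  have h : ∀ k < 9, mulc (mulc (lft 0 k) (lft 0 k)) (rgt 0 k) = lft 0 k := by decide
  rw [LinearMap.comp_apply, bimod_single, one_smul, ← A.pure_one, aug_single_pure, one_mul, mul_one]
  by_cases hk : k < 9
  · rw [idem, ev_singleton, tens, aug_single_pure, A.pth_mul, A.pth_mul, h k hk]
  · rw [ev_idem_junk A _ (not_lt.1 hk), map_zero, lft_eq_junk _ (not_lt.1 hk), A.pth_junk]

/-- The term of degree `n` of the resolution. -/
noncomputable def Res (n : ℕ) : Submodule Λ (FreeMod Λ) := LinearMap.range (proj A n)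

theorem proj_of_mem {n : ℕ} {z : FreeMod Λ} (hz : z ∈ Res A n) : proj A n z = z := by
  obtain ⟨y, rfl⟩ := hz
  exact proj_proj A n y

theorem dif_mem (n : ℕ) (z : FreeMod Λ) : dif A n z ∈ Res A n := ⟨_, proj_dif A n z⟩

theorem projective_res (n : ℕ) : Module.Projective Λ (Res A n) :=
  Module.Projective.of_split (Res A n).subtype (proj A n).rangeRestrict
    (LinearMap.ext fun z => Subtype.ext (proj_of_mem A z.2))

/-- The differential of the resolution. -/
noncomputable def resD (n : ℕ) : Res A (n + 1) →ₗ[Λ] Res A n :=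
  ((dif A n).comp (Res A (n + 1)).subtype).codRestrict (Res A n) fun z => dif_mem A n z

theorem coe_resD (n : ℕ) (z : Res A (n + 1)) : (resD A n z : FreeMod Λ) = dif A n z := rfl

/-- The augmentation of the resolution. -/
noncomputable def resAug : Res A 0 →ₗ[Λ] R := (aug A).comp (Res A 0).subtype

theorem resD_resD (n : ℕ) (z : Res A (n + 1 + 1)) : resD A n (resD A (n + 1) z) = 0 :=
  Subtype.ext (dif_dif A n z)

theorem resAug_resD [IsScalarTower K Λ R] (z : Res A 1) : resAug A (resD A 0 z) = 0 := aug_dif A z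

theorem resAug_surjective [IsScalarTower K Λ R] : Function.Surjective (resAug A) := fun r =>
  ⟨⟨_, _, rfl⟩, (aug_proj A (split A r)).trans (aug_split A r)⟩

theorem exists_resD_eq (n : ℕ) (z : Res A (n + 1)) (hz : resD A n z = 0) :
    ∃ y, resD A (n + 1) y = z := by
  have hz' : dif A n (proj A (n + 1) z) = 0 := by
    rw [proj_of_mem A z.2, ← coe_resD, hz, ZeroMemClass.coe_zero]
  have := homotopy_succ A n z
  rw [hz', map_zero, add_zero, ← dif_proj, proj_of_mem A z.2] at this
  exact ⟨⟨_, _, rfl⟩, Subtype.ext this⟩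

theorem exists_resD_zero_eq [IsScalarTower K Λ R] (z : Res A 0) (hz : resAug A z = 0) : ∃ y, resD A 0 y = z := by
  have hz' : aug A (proj A 0 z) = 0 := by
    rw [proj_of_mem A z.2]
    exact hz
  have := homotopy_zero A (z : FreeMod Λ)
  rw [hz', map_zero, add_zero, ← dif_proj, proj_of_mem A z.2] at this
  exact ⟨⟨_, _, rfl⟩, Subtype.ext this⟩

/-- The complex of the resolution. -/
noncomputable def resComplex : ChainComplex (ModuleCat.{u} Λ) ℕ :=
  ChainComplex.of (fun n => ModuleCat.of Λ (Res A n)) (fun n => ModuleCat.ofHom (resD A n))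
    fun n => by
      ext z
      exact DFunLike.congr_fun (congrArg Subtype.val (resD_resD A n z)) _

theorem resComplex_d (n : ℕ) : (resComplex A).d (n + 1) n = ModuleCat.ofHom (resD A n) :=
  ChainComplex.of_d (fun n => ModuleCat.of Λ (Res A n)) (fun n => ModuleCat.ofHom (resD A n)) n

/-- The augmentation of the complex. -/
noncomputable def resπ [IsScalarTower K Λ R] :
    resComplex A ⟶ (ChainComplex.single₀ (ModuleCat.{u} Λ)).obj (ModuleCat.of Λ R) :=
  ((resComplex A).toSingle₀Equiv _).symm ⟨ModuleCat.ofHom (resAug A), by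
    rw [resComplex_d]
    ext z
    exact resAug_resD A z⟩

theorem resπ_f_zero [IsScalarTower K Λ R] : (resπ A).f 0 = ModuleCat.ofHom (resAug A) :=
  ChainComplex.toSingle₀Equiv_symm_apply_f_zero ..

theorem resπ_quasiIso [IsScalarTower K Λ R] : QuasiIso (resπ A) where
  quasiIsoAt m := by
    cases m with
    | zero =>
      rw [ChainComplex.quasiIsoAt₀_iff, ShortComplex.quasiIso_iff_of_zeros' _ rfl rfl rfl]
      constructor
      · rw [ShortComplex.moduleCat_exact_iff]
        intro z hz
        change (resπ A).f 0 z = 0 at hz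
        rw [resπ_f_zero] at hz
        obtain ⟨y, hy⟩ := exists_resD_zero_eq A z hz
        refine ⟨y, ?_⟩
        rw [← hy]
        change (resComplex A).d (0 + 1) 0 y = _
        rw [resComplex_d]
        rfl
      · rw [ModuleCat.epi_iff_surjective]
        intro r
        obtain ⟨z, hz⟩ := resAug_surjective A r
        refine ⟨z, ?_⟩
        rw [← hz]
        change (resπ A).f 0 z = _
        rw [resπ_f_zero]
        rfl
    | succ m =>
      rw [quasiIsoAt_iff_exactAt' (hL := ChainComplex.exactAt_succ_single_obj ..),
        HomologicalComplex.exactAt_iff' _ (m + 2) (m + 1) m (by simp) (by simp),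
        ShortComplex.moduleCat_exact_iff]
      intro z hz
      change (resComplex A).d (m + 1) m z = 0 at hz
      rw [resComplex_d] at hz
      obtain ⟨y, hy⟩ := exists_resD_eq A m z hz
      refine ⟨y, ?_⟩
      rw [← hy]
      change (resComplex A).d (m + 1 + 1) (m + 1) y = _
      rw [resComplex_d]
      rfl

/-- The projective resolution. -/
noncomputable def projRes [IsScalarTower K Λ R] : ProjectiveResolution (ModuleCat.of Λ R) where
  complex := resComplex A
  projective n := by
    have := projective_res A n
    exact ModuleCat.projective_of_categoryTheory_projective (ModuleCat.of Λ (Res A n))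
  π := resπ A
  quasiIso := resπ_quasiIso A

theorem finrank_homology (S : ShortComplex (ModuleCat.{u} K)) [Module.Finite K S.X₂] :
    Module.finrank K S.homology + Module.finrank K (LinearMap.range S.f.hom) +
      Module.finrank K (LinearMap.range S.g.hom) = Module.finrank K S.X₂ := by
  have h1 : Module.finrank K S.homology = Module.finrank K
      (LinearMap.ker S.g.hom ⧸ LinearMap.range S.moduleCatToCycles) :=
    LinearEquiv.finrank_eq S.moduleCatHomologyIso.toLinearEquiv
  have h2 := Submodule.finrank_quotient_add_finrank (LinearMap.range S.moduleCatToCycles)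
  have h3 := LinearMap.finrank_range_add_finrank_ker S.g.hom
  have h4 : Module.finrank K (LinearMap.range S.f.hom) =
      Module.finrank K (LinearMap.range S.moduleCatToCycles) := by
    have : LinearMap.range S.f.hom =
        (LinearMap.range S.moduleCatToCycles).map (LinearMap.ker S.g.hom).subtype := by
      rw [← LinearMap.range_comp]
      rfl
    rw [this, Submodule.finrank_map_subtype_eq]
  lia

/-- The coordinate of an element of `R` at the path with code `x`. -/
noncomputable def coord (x : ℕ) : R →ₗ[K] K :=
  if h : x ∈ paths then A.basis.coord ⟨x, h⟩ else 0

theorem coord_of_mem {x : ℕ} (hx : x ∈ paths) : coord A x = A.basis.coord ⟨x, hx⟩ := dif_pos hx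

theorem coord_pth {x : ℕ} (hx : x ∈ paths) (y : ℕ) :
    coord A x (A.pth y) = if y = x then 1 else 0 := by
  rw [coord_of_mem A hx]
  by_cases hy : y ∈ paths
  · rw [show A.pth y = A.basis ⟨y, hy⟩ from (A.basis_apply ⟨y, hy⟩).symm, Module.Basis.coord_apply,
      Module.Basis.repr_self, Finsupp.single_apply]
    simp only [Subtype.mk.injEq]
  · rw [A.pth_eq_zero y hy, map_zero, if_neg]
    rintro rfl
    exact hy hx

theorem eq_zero_of_coord (r : R) (h : ∀ x ∈ paths, coord A x r = 0) : r = 0 := by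
  refine A.basis.ext_elem fun c => ?_
  rw [map_zero, Finsupp.zero_apply, ← Module.Basis.coord_apply, ← coord_of_mem A c.2, h _ c.2]

/-- The pairs `(k, x)` of a summand in degree `n` and a parallel path `x`. -/
def homBasis (n : ℕ) : List (ℕ × ℕ) :=
  (List.range 9).flatMap fun k =>
    (paths.filter fun x => Nat.beq (mulc (mulc (lft n k) x) (rgt n k)) x).map (Prod.mk k)

theorem mem_homBasis {n k x : ℕ} : (k, x) ∈ homBasis n ↔
    k < 9 ∧ x ∈ paths ∧ mulc (mulc (lft n k) x) (rgt n k) = x := by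
  simp only [homBasis, List.mem_flatMap, List.mem_range, List.mem_map, List.mem_filter,
    Prod.mk.injEq, Nat.beq_eq]
  constructor
  · rintro ⟨_, h, _, h', rfl, rfl⟩
    exact ⟨h, h'⟩
  · rintro ⟨h, h'⟩
    exact ⟨k, h, x, h', rfl, rfl⟩

theorem homBasis_add (n : ℕ) : homBasis (n + 22) = homBasis n := by
  simp only [homBasis, lft_add, rgt_add]

theorem nodup_homBasis (n : ℕ) : (homBasis n).Nodup := by
  have h : ∀ n < 22, (homBasis n).Nodup := by decide +kernel
  exact of_periodic (fun n => (homBasis n).Nodup) (fun n hn => (homBasis_add n).symm ▸ hn) h n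

theorem mulc_mulc_eq_or (n : ℕ) {k y : ℕ} (hk : k < 9) (hy : y ∈ paths) :
    mulc (mulc (lft n k) y) (rgt n k) = y ∨ mulc (mulc (lft n k) y) (rgt n k) = 999 := by
  have h : ∀ n < 22, ∀ k < 9, ∀ y ∈ paths,
      Nat.beq (mulc (mulc (lft n k) y) (rgt n k)) y = true ∨
        Nat.beq (mulc (mulc (lft n k) y) (rgt n k)) 999 = true := by decide +kernel
  simp only [Nat.beq_eq] at h
  exact of_periodic (fun n => ∀ k < 9, ∀ y ∈ paths,
      mulc (mulc (lft n k) y) (rgt n k) = y ∨ mulc (mulc (lft n k) y) (rgt n k) = 999)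
    (fun n hn => by simpa only [lft_add, rgt_add] using hn) h n k hk y hy

theorem coord_mul_mul (n : ℕ) {k x : ℕ} (hk : k < 9) (hx : x ∈ paths)
    (h : (k, x) ∉ homBasis n) (r : R) :
    coord A x (A.pth (lft n k) * r * A.pth (rgt n k)) = 0 := by
  have : (coord A x).comp ((LinearMap.mulRight K (A.pth (rgt n k))).comp
      (LinearMap.mulLeft K (A.pth (lft n k)))) = 0 := by
    refine A.basis.ext fun c => ?_
    rw [A.basis_apply]
    change coord A x (A.pth (lft n k) * A.pth c * A.pth (rgt n k)) = 0
    rw [A.pth_mul, A.pth_mul, coord_pth A hx, if_neg]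
    intro h'
    rcases mulc_mulc_eq_or n hk c.2 with h1 | h1
    · obtain rfl := h1.symm.trans h'
      exact h (mem_homBasis.2 ⟨hk, hx, h1⟩)
    · obtain rfl := h1.symm.trans h'
      revert hx
      decide
  exact LinearMap.congr_fun this r

theorem linearCombination_ev [IsScalarTower K Λ R] (f : ℕ → R) (l : List Term) :
    Finsupp.linearCombination Λ f (ev A l) =
      (l.map fun t => (t.1 : K) • (A.pth t.2.2.1 * f t.2.1 * A.pth t.2.2.2)).sum := by
  refine (map_ev A ((Finsupp.linearCombination Λ f).restrictScalars K) l).trans ?_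
  congr 1
  refine List.map_congr_left fun t _ => ?_
  rw [evTerm, map_smul, LinearMap.restrictScalars_apply, Finsupp.linearCombination_single, tens,
    A.pure_smul]

/-- The generator of the `k`-th summand as an element of the resolution. -/
noncomputable def resGen (n k : ℕ) : Res A n :=
  ⟨ev A (idem n k), Finsupp.single k 1, by rw [bimod_single, one_smul]⟩

theorem resD_resGen (n k : ℕ) : (resD A n (resGen A (n + 1) k) : FreeMod Λ) = ev A (diff n k) := by
  have := dif_proj A n (Finsupp.single k 1)
  rwa [bimod_single, one_smul, bimod_single, one_smul] at this

/-- The homomorphism sending the generator of the `k`-th summand to the path `x`. -/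
noncomputable def resHom (n k x : ℕ) : Res A n →ₗ[Λ] R :=
  (Finsupp.linearCombination Λ fun k' => if k' = k then A.pth x else 0).comp (Res A n).subtype

theorem resHom_resGen [IsScalarTower K Λ R] (n k x k' : ℕ) : resHom A n k x (resGen A n k') =
    if k' = k then A.pth (mulc (mulc (lft n k') x) (rgt n k')) else 0 := by
  change Finsupp.linearCombination Λ _ (ev A (idem n k')) = _
  rw [linearCombination_ev, idem, List.map_singleton, List.sum_singleton, Int.cast_one, one_smul]
  simp only
  split_ifs with h
  · rw [A.pth_mul, A.pth_mul]
  · rw [mul_zero, zero_mul]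

theorem apply_resGen (n k : ℕ) (φ : Res A n →ₗ[Λ] R) :
    A.pth (lft n k) * φ (resGen A n k) * A.pth (rgt n k) = φ (resGen A n k) := by
  rw [← A.pure_smul, ← map_smul]
  congr 1
  refine Subtype.ext ?_
  have := proj_proj A n (Finsupp.single k 1)
  rw [bimod_single, one_smul, idem, ev_singleton, bimod_single, idem, ev_singleton] at this
  change _ • ev A (idem n k) = ev A (idem n k)
  rw [idem, ev_singleton]
  exact this

theorem resHom_ext (n : ℕ) (φ : Res A n →ₗ[Λ] R) (h : ∀ k < 9, φ (resGen A n k) = 0) :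
    φ = 0 := by
  have : φ.comp (proj A n).rangeRestrict = 0 := by
    refine Finsupp.lhom_ext' fun k => LinearMap.ext_ring ?_
    have hk : (proj A n).rangeRestrict (Finsupp.single k 1) = resGen A n k :=
      Subtype.ext (by
        change bimod A _ _ = ev A _
        rw [bimod_single, one_smul])
    change φ ((proj A n).rangeRestrict (Finsupp.single k 1)) = 0
    rw [hk]
    by_cases hk' : k < 9
    · exact h k hk'
    · have : resGen A n k = 0 := Subtype.ext (ev_idem_junk A n (not_lt.1 hk'))
      rw [this, map_zero]
  refine LinearMap.ext fun z => ?_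
  obtain ⟨y, rfl⟩ := LinearMap.surjective_rangeRestrict (proj A n) z
  exact LinearMap.congr_fun this y

variable [IsScalarTower K Λ R] [SMulCommClass Λ K R]

/-- The coordinates of a homomorphism from a term of the resolution to `R`. -/
noncomputable def homCoord (n : ℕ) :
    (Res A n →ₗ[Λ] R) →ₗ[K] (Fin (homBasis n).length → K) where
  toFun φ i := coord A ((homBasis n).get i).2 (φ (resGen A n ((homBasis n).get i).1))
  map_add' φ ψ := by
    funext i
    rw [LinearMap.add_apply, map_add]
    rfl
  map_smul' c φ := by
    funext i
    rw [LinearMap.smul_apply, map_smul]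
    rfl

omit [IsScalarTower K Λ R] in
theorem homCoord_apply (n : ℕ) (φ : Res A n →ₗ[Λ] R) (i) : homCoord A n φ i =
    coord A ((homBasis n).get i).2 (φ (resGen A n ((homBasis n).get i).1)) := rfl

theorem get_mem_homBasis (n : ℕ) (i : Fin (homBasis n).length) :
    ((homBasis n).get i).1 < 9 ∧ ((homBasis n).get i).2 ∈ paths ∧
      mulc (mulc (lft n ((homBasis n).get i).1) ((homBasis n).get i).2)
        (rgt n ((homBasis n).get i).1) = ((homBasis n).get i).2 :=
  mem_homBasis.1 (List.get_mem _ _)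

theorem homCoord_resHom (n : ℕ) (i : Fin (homBasis n).length) :
    homCoord A n (resHom A n ((homBasis n).get i).1 ((homBasis n).get i).2) = Pi.single i 1 := by
  funext j
  rw [homCoord_apply, resHom_resGen, Pi.single_apply]
  by_cases h : ((homBasis n).get j).1 = ((homBasis n).get i).1
  · rw [if_pos h, h, (get_mem_homBasis n i).2.2, coord_pth A (get_mem_homBasis n j).2.1]
    refine if_congr ⟨fun h' => ?_, fun h' => by rw [h']⟩ rfl rfl
    exact (nodup_homBasis n).injective_get (Prod.ext h h'.symm)
  · rw [if_neg h, map_zero, if_neg]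
    rintro rfl
    exact h rfl

theorem homCoord_injective (n : ℕ) : Function.Injective (homCoord A n) := by
  rw [injective_iff_map_eq_zero]
  intro φ hφ
  refine resHom_ext A n φ fun k hk => eq_zero_of_coord A _ fun x hx => ?_
  by_cases h : (k, x) ∈ homBasis n
  · obtain ⟨i, hi⟩ := List.mem_iff_get.1 h
    have := congrFun hφ i
    rwa [homCoord_apply, hi] at this
  · rw [← apply_resGen]
    exact coord_mul_mul A n hk hx h _

theorem homCoord_surjective (n : ℕ) : Function.Surjective (homCoord A n) := by
  rw [← LinearMap.range_eq_top, eq_top_iff, ← (Pi.basisFun K _).span_eq, Submodule.span_le]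
  rintro _ ⟨i, rfl⟩
  rw [Pi.basisFun_apply]
  exact ⟨_, homCoord_resHom A n i⟩

/-- The space of homomorphisms from a term of the resolution to `R`, in coordinates. -/
noncomputable def homEquiv (n : ℕ) : (Res A n →ₗ[Λ] R) ≃ₗ[K] (Fin (homBasis n).length → K) :=
  LinearEquiv.ofBijective (homCoord A n) ⟨homCoord_injective A n, homCoord_surjective A n⟩

/-- The coefficient at `y` of the image under the coboundary of the homomorphism given by `x`. -/
def cobEntry (n : ℕ) (y x : ℕ × ℕ) : ℤ :=
  ((diff n y.1).map fun t =>
    if Nat.beq t.2.1 x.1 && Nat.beq (mulc (mulc t.2.2.1 x.2) t.2.2.2) y.2 then t.1 else 0).sum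

/-- The matrix of the coboundary. -/
def cobMatrix (n : ℕ) :
    Matrix (Fin (homBasis (n + 1)).length) (Fin (homBasis n).length) ℤ :=
  Matrix.of fun j i => cobEntry n ((homBasis (n + 1)).get j) ((homBasis n).get i)

/-- The coboundary of the complex of homomorphisms from the resolution to `R`. -/
noncomputable def cob (n : ℕ) : (Res A n →ₗ[Λ] R) →ₗ[K] (Res A (n + 1) →ₗ[Λ] R) where
  toFun φ := φ.comp (resD A n)
  map_add' _ _ := rfl
  map_smul' _ _ := rfl

theorem homCoord_cob_resHom (n : ℕ) (i : Fin (homBasis n).length)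
    (j : Fin (homBasis (n + 1)).length) :
    homCoord A (n + 1) (cob A n (resHom A n ((homBasis n).get i).1 ((homBasis n).get i).2)) j =
      (cobMatrix n j i : K) := by
  have hj := (get_mem_homBasis (n + 1) j).2.1
  rw [homCoord_apply, cobMatrix, Matrix.of_apply]
  generalize (homBasis (n + 1)).get j = y at hj
  generalize (homBasis n).get i = x
  change coord A y.2 (Finsupp.linearCombination Λ _ (resD A n (resGen A (n + 1) y.1)).1) = _
  rw [resD_resGen, linearCombination_ev, map_list_sum, List.map_map, cobEntry]
  have hc (l : List ℤ) : ((l.sum : ℤ) : K) = (l.map (Int.cast : ℤ → K)).sum :=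
    map_list_sum (Int.castRingHom K) l
  rw [hc, List.map_map]
  congr 1
  refine List.map_congr_left fun t _ => ?_
  simp only [Function.comp_apply, map_smul, Bool.and_eq_true, Nat.beq_eq]
  by_cases h : t.2.1 = x.1
  · rw [if_pos h, A.pth_mul, A.pth_mul, coord_pth A hj]
    by_cases h' : mulc (mulc t.2.2.1 x.2) t.2.2.2 = y.2
    · rw [if_pos h', if_pos ⟨h, h'⟩, smul_eq_mul, mul_one]
    · rw [if_neg h', if_neg fun h'' => h' h''.2, smul_zero, Int.cast_zero]
  · rw [if_neg h, if_neg fun h'' => h h''.1, mul_zero, zero_mul, map_zero, smul_zero, Int.cast_zero]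

theorem homCoord_cob (n : ℕ) (φ : Res A n →ₗ[Λ] R) : homCoord A (n + 1) (cob A n φ) =
    Matrix.mulVecLin ((cobMatrix n).map (Int.cast : ℤ → K)) (homCoord A n φ) := by
  obtain ⟨c, rfl⟩ := (homEquiv A n).symm.surjective φ
  have : ((homCoord A (n + 1)).comp (cob A n)).comp (homEquiv A n).symm.toLinearMap =
      (Matrix.mulVecLin ((cobMatrix n).map (Int.cast : ℤ → K))) := by
    refine (Pi.basisFun K _).ext fun i => ?_
    have hi : (homEquiv A n).symm (Pi.single i 1) =
        resHom A n ((homBasis n).get i).1 ((homBasis n).get i).2 := by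
      rw [LinearEquiv.symm_apply_eq]
      exact (homCoord_resHom A n i).symm
    rw [Pi.basisFun_apply, LinearMap.comp_apply, LinearEquiv.coe_coe, hi]
    funext j
    rw [LinearMap.comp_apply, homCoord_cob_resHom, Matrix.mulVecLin_apply, Matrix.mulVec_single_one]
    rfl
  refine (LinearMap.congr_fun this c).trans ?_
  congr 1
  exact ((homEquiv A n).apply_symm_apply c).symm

/-- The rank over `K` of the coboundary in degree `n`. -/
noncomputable def cobRank (K : Type u) [Field K] (n : ℕ) : ℕ :=
  ((cobMatrix n).map (Int.cast : ℤ → K)).rank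

theorem finrank_range_cob (n : ℕ) : Module.finrank K (LinearMap.range (cob A n)) =
    cobRank K n := by
  have h : (homEquiv A (n + 1)).toLinearMap.comp (cob A n) =
      (Matrix.mulVecLin ((cobMatrix n).map (Int.cast : ℤ → K))).comp
        (homEquiv A n).toLinearMap := LinearMap.ext fun φ => homCoord_cob A n φ
  rw [cobRank, Matrix.rank, ← LinearMap.range_comp_of_range_eq_top _ (homEquiv A n).range, ← h,
    LinearMap.range_comp]
  exact (LinearEquiv.finrank_map_eq (homEquiv A (n + 1)) _).symm

/-- The cochain complex computing the extensions of `R` by itself. -/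
noncomputable abbrev homComplex : CochainComplex (ModuleCat.{u} K) ℕ :=
  (projRes A).complex.linearYonedaObj K (ModuleCat.of Λ R)

omit [IsScalarTower K Λ R] [SMulCommClass Λ K R] in
theorem smul_hom_apply (M N : ModuleCat.{u} Λ) (c : K) (f : M ⟶ N) (z : M) :
    (c • f).hom z = algebraMap K Λ c • f.hom z := rfl

/-- The terms of the cochain complex. -/
noncomputable def homComplexEquiv (n : ℕ) :
    (homComplex A).X n ≃ₗ[K] (Res A n →ₗ[Λ] R) where
  toFun f := (show ModuleCat.of Λ (Res A n) ⟶ ModuleCat.of Λ R from f).hom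
  invFun f := (ModuleCat.ofHom f : ModuleCat.of Λ (Res A n) ⟶ ModuleCat.of Λ R)
  map_add' _ _ := rfl
  map_smul' c f := LinearMap.ext fun z =>
    (smul_hom_apply (ModuleCat.of Λ (Res A n)) (ModuleCat.of Λ R) c f z).trans
      (algebraMap_smul Λ c _)
  left_inv _ := rfl
  right_inv _ := rfl

theorem homComplexEquiv_d (n : ℕ) (f : (homComplex A).X n) :
    homComplexEquiv A (n + 1) ((homComplex A).d n (n + 1) f) = cob A n (homComplexEquiv A n f) := by
  change (show ModuleCat.of Λ (Res A (n + 1)) ⟶ ModuleCat.of Λ R from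
    (resComplex A).d (n + 1) n ≫ (show ModuleCat.of Λ (Res A n) ⟶ ModuleCat.of Λ R from f)).hom = _
  rw [resComplex_d]
  rfl

theorem finrank_homComplex_X (n : ℕ) :
    Module.finrank K ((homComplex A).X n) = (homBasis n).length := by
  rw [((homComplexEquiv A n).trans (homEquiv A n)).finrank_eq, Module.finrank_fin_fun]

instance finite_homComplex_X (n : ℕ) : Module.Finite K ((homComplex A).X n) :=
  Module.Finite.equiv ((homComplexEquiv A n).trans (homEquiv A n)).symm

theorem finrank_range_d (n : ℕ) :
    Module.finrank K (LinearMap.range ((homComplex A).d n (n + 1)).hom) = cobRank K n := by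
  rw [← finrank_range_cob A n]
  have h : (homComplexEquiv A (n + 1)).toLinearMap.comp ((homComplex A).d n (n + 1)).hom =
      (cob A n).comp (homComplexEquiv A n).toLinearMap :=
    LinearMap.ext fun f => homComplexEquiv_d A n f
  rw [← LinearMap.range_comp_of_range_eq_top (cob A n) (homComplexEquiv A n).range, ← h,
    LinearMap.range_comp]
  exact (LinearEquiv.finrank_map_eq (homComplexEquiv A (n + 1)) _).symm

theorem finrank_homology_zero :
    Module.finrank K ((homComplex A).homology 0) + cobRank K 0 = (homBasis 0).length := by
  have : Module.Finite K ((homComplex A).sc' 0 0 1).X₂ := finite_homComplex_X A 0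
  have h := finrank_homology ((homComplex A).sc' 0 0 1)
  have e := (ShortComplex.homologyMapIso ((homComplex A).isoSc' 0 0 1 (by simp)
    (by simp))).toLinearEquiv.finrank_eq
  have h0 : ((homComplex A).sc' 0 0 1).f = 0 := (homComplex A).shape 0 0 (by simp)
  rw [h0, ModuleCat.hom_zero, LinearMap.range_zero, finrank_bot] at h
  rw [← finrank_homComplex_X A 0, ← finrank_range_d A 0]
  refine Eq.trans ?_ h
  rw [add_zero]
  exact congrArg (· + _) e

theorem finrank_homology_succ (n : ℕ) :
    Module.finrank K ((homComplex A).homology (n + 1)) + cobRank K n + cobRank K (n + 1) =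
      (homBasis (n + 1)).length := by
  have : Module.Finite K ((homComplex A).sc' n (n + 1) (n + 1 + 1)).X₂ :=
    finite_homComplex_X A (n + 1)
  have h := finrank_homology ((homComplex A).sc' n (n + 1) (n + 1 + 1))
  have e := (ShortComplex.homologyMapIso ((homComplex A).isoSc' n (n + 1) (n + 1 + 1) (by simp)
    (by simp))).toLinearEquiv.finrank_eq
  rw [← finrank_homComplex_X A (n + 1), ← finrank_range_d A n, ← finrank_range_d A (n + 1)]
  refine Eq.trans ?_ h
  exact congrArg (· + _ + _) e

omit [SMulCommClass Λ K R] in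
theorem finrank_Ext (n : ℕ) :
    Module.finrank K (((Ext K (ModuleCat.{u} Λ) n).obj
      (Opposite.op (ModuleCat.of Λ R))).obj (ModuleCat.of Λ R)) =
      Module.finrank K ((homComplex A).homology n) :=
  ((projRes A).isoExt n (ModuleCat.of Λ R)).toLinearEquiv.finrank_eq

include A in
theorem finrank_Ext_zero :
    Module.finrank K (((Ext K (ModuleCat.{u} Λ) 0).obj
      (Opposite.op (ModuleCat.of Λ R))).obj (ModuleCat.of Λ R)) + cobRank K 0 =
      (homBasis 0).length := by
  rw [finrank_Ext A, finrank_homology_zero]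

include A in
theorem finrank_Ext_succ (n : ℕ) :
    Module.finrank K (((Ext K (ModuleCat.{u} Λ) (n + 1)).obj
      (Opposite.op (ModuleCat.of Λ R))).obj (ModuleCat.of Λ R)) + cobRank K n +
      cobRank K (n + 1) = (homBasis (n + 1)).length := by
  rw [finrank_Ext A, finrank_homology_succ]

end Resolution

/-- For each degree, a decomposition of the matrix of the coboundary as a sum of multiples `d x yᵀ`
of matrices of rank one: the entries are `(d, x, y, a, b)`, where the `a` are dual to the `x` and
the `b` are dual to the `y`. -/
def rankTable : List (List (ℕ × List ℤ × List ℤ × List ℤ × List ℤ)) := [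
  [(1, [0, -1, 1, 0, 0, 0, 0], [-1, 0, 1, 0, 0, 0, 0, 0, 0, 0, 0, 0], [0, -1, 0, 0, 0, 0, 0],
  [0, 0, 1, 0, 0, 0, 0, 0, 0, 0, 0, 0]), (1, [0, 0, -1, 0, 0, 1, 0],
  [-1, 0, 0, 0, 1, 0, 0, 0, 0, 0, 0, 0], [0, -1, -1, 0, 0, 0, 0],
  [0, 0, 0, 0, 1, 0, 0, 0, 0, 0, 0, 0]), (1, [0, 0, 0, -1, 1, 0, 0],
  [-1, 0, 0, 0, 0, 0, 1, 0, 0, 0, 0, 0], [0, 0, 0, -1, 0, 0, 0],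
  [0, 0, 0, 0, 0, 0, 1, 0, 0, 0, 0, 0]), (1, [0, 0, 0, 0, -1, 0, 1],
  [-1, 0, 0, 0, 0, 0, 0, 0, 1, 0, 0, 0], [0, 0, 0, -1, -1, 0, 0],
  [0, 0, 0, 0, 0, 0, 0, 0, 1, 0, 0, 0]), (1, [1, 0, 0, 0, 0, 1, 1],
  [1, 0, 0, 0, 0, 0, 0, 0, 0, 0, -1, 0], [1, 0, 0, 0, 0, 0, 0],
  [1, 0, 1, 0, 1, 0, 1, 0, 1, 0, 0, 0])],
  [(1, [1, 0, 0, 0], [0, 1, 1, -1, -1, 1, -1], [1, 0, 0, 0], [0, 1, 0, 0, 0, 0, 0])],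
  [(1, [0, 0, 0, -1, 0, 0, -1, 0], [0, 0, 1, 0], [0, 0, 0, -1, 0, 0, 0, 0], [0, 0, 1, 0]), (1,
  [0, 0, 0, 0, 0, -1, 0, -1], [0, 0, 0, 1], [0, 0, 0, 0, 0, -1, 0, 0], [0, 0, 0, 1]), (1,
  [-1, -1, -1, 0, -1, 0, 0, 0], [0, 1, 0, 0], [0, 0, -1, 0, 0, 0, 0, 0], [0, 1, 0, 0])],
  [(1, [1, 0, 0, 0, 1, 0, 0], [1, 0, -1, 0, 0, 0, 0, 0], [1, 0, 0, 0, 0, 0, 0],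
  [1, 0, 0, 0, 0, 0, 0, 0]), (1, [0, 1, 0, 0, -1, 0, 0], [0, 1, 0, 0, -1, 0, 0, 0],
  [0, 1, 0, 0, 0, 0, 0], [0, 1, 0, 0, 0, 0, 0, 0]), (1, [0, 0, 1, 0, 0, 0, 0],
  [0, 0, 0, 1, 0, 1, -1, -1], [0, 0, 1, 0, 0, 0, 0], [0, 0, 0, 1, 0, 0, 0, 0]), (1,
  [0, 0, 0, 0, 1, 0, 1], [0, 0, 1, 0, -1, -1, 0, 1], [-1, 1, 0, 0, 1, 0, 0],
  [1, 0, 1, 0, 0, 0, 0, 0]), (2, [0, 0, 0, 0, 0, 0, 1], [0, 0, 0, 0, 0, 1, 0, -1],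
  [1, -1, 0, 0, -1, 0, 1], [1, 0, 1, -1, 0, 1, 0, 0])],
  [(1, [-1, 1, 0, 0, 1, 1, 0, 0], [0, 0, 0, 1, 0, 0, 0], [-1, 0, 0, 0, 0, 0, 0, 0],
  [0, 0, 0, 1, 0, 0, 0]), (1, [0, 0, 1, -1, 0, 0, -1, -1], [0, 0, 0, 0, 0, 1, 0],
  [0, 0, 1, 0, 0, 0, 0, 0], [0, 0, 0, 0, 0, 1, 0])],
  [(1, [0, -1, 0, 1, 0, 0, 0, 0, 0, 0, 0, 0, 0], [1, 0, 0, 0, 1, 0, 0, 0],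
  [0, 0, 0, 1, 0, 0, 0, 0, 0, 0, 0, 0, 0], [0, 0, 0, 0, 1, 0, 0, 0]), (1,
  [0, 0, 0, 0, 0, 1, 0, 0, 0, 0, 0, 1, 0], [0, 0, 1, 0, 0, 0, 1, 0],
  [0, 0, 0, 0, 0, 1, 0, 0, 0, 0, 0, 0, 0], [0, 0, 0, 0, 0, 0, 1, 0]), (1,
  [0, 1, 0, 0, 0, 0, 0, -1, 0, 0, 0, 0, 0], [0, -1, 0, 0, 0, 1, 0, 0],
  [0, 0, 0, 0, 0, 0, 0, -1, 0, 0, 0, 0, 0], [0, 0, 0, 0, 0, 1, 0, 0]), (1,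
  [0, 0, 0, 0, 0, 0, 0, 0, 0, -1, 0, -1, 0], [0, 0, 0, -1, 0, 0, 0, 1],
  [0, 0, 0, 0, 0, 0, 0, 0, 0, -1, 0, 0, 0], [0, 0, 0, 0, 0, 0, 0, 1]), (1,
  [0, -1, 0, 0, 0, 0, 0, 0, 0, 0, 0, -2, 0], [-2, -2, 1, 1, 0, 0, 0, 0],
  [0, -1, 0, -1, 0, 0, 0, -1, 0, 0, 0, 0, 0], [0, 0, 1, 0, 0, 0, -1, 0]), (3,
  [0, 0, 0, 0, 0, 0, 0, 0, 0, 0, 0, -1, 0], [1, 1, 0, 0, 0, 0, 0, 0],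
  [0, 2, 0, 2, 0, 1, 0, 2, 0, 1, 0, -1, 0], [1, 0, 2, 0, -1, 0, -2, 0])],
  [(1, [1, 0, 0, 1, 0, 0, 1, 0], [0, 0, 0, 0, 1, 0, 0, 0, 0, 0, 0, 0, 1],
  [1, 0, 0, 0, 0, 0, 0, 0], [0, 0, 0, 0, 1, 0, 0, 0, 0, 0, 0, 0, 0]), (1,
  [0, 0, 0, 0, 1, 1, 0, 1], [0, 0, 0, 0, 0, 0, 1, 0, 0, 0, 0, 0, 1], [0, 0, 0, 0, 1, 0, 0, 0],
  [0, 0, 0, 0, 0, 0, 1, 0, 0, 0, 0, 0, 0]), (1, [0, 0, 1, 1, 0, 0, 1, 0],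
  [1, 0, 1, 0, 0, 0, 0, 0, 0, 0, 0, 0, -1], [-1, 0, 0, 1, 0, 0, 0, 0],
  [0, 0, 1, 0, 0, 0, 0, 0, 0, 0, 0, 0, 0]), (1, [0, -1, -1, 0, 0, 0, -1, -1],
  [0, 0, 0, 0, 0, 0, 0, 0, 0, 0, 1, 0, 0], [-1, 0, -1, 1, 0, 0, 0, 0],
  [0, 0, 0, 0, 0, 0, 0, 0, 0, 0, 1, 0, 0]), (1, [0, 1, 0, 0, 0, 1, -1, 0],
  [1, 0, 0, 0, 0, 0, 0, 0, 0, 0, 0, 0, 0], [1, 0, 1, 0, 0, 0, -1, 0],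
  [1, 0, -1, 0, 0, 0, 0, 0, 0, 0, 0, 0, 0]), (1, [0, 1, 0, 0, 0, 1, 0, 1],
  [0, 0, 0, 0, 0, 0, 0, 0, 1, 0, 0, 0, -1], [-1, 0, -1, 0, -1, 1, 1, 0],
  [0, 0, 0, 0, 0, 0, 0, 0, 1, 0, 0, 0, 0])],
  [(1, [1, 0, 0, 0], [0, 0, 0, 1, 0, -1, -1, 1], [1, 0, 0, 0], [0, 0, 0, 1, 0, 0, 0, 0])],
  [(1, [-1, 0, 1, 0, 1], [0, -1, 1, 0], [-1, 0, 0, 0, 0], [0, 0, 1, 0]), (1, [0, 1, 0, -1, 1],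
  [0, 1, 0, -1], [0, 1, 0, 0, 0], [0, 1, 1, 0])],
  [(1, [0, 1, 0, 0], [1, -1, 0, 0, 1], [0, 1, 0, 0], [1, 0, 0, 0, 0]), (1, [0, 0, 0, 1],
  [0, 0, 1, -1, -1], [0, 0, 0, 1], [0, 0, 1, 0, 0])],
  [(1, [0, 1, 0, 0], [0, 0, 1, 0], [0, 1, 0, 0], [0, 0, 1, 0]), (1, [0, 0, 0, 1], [1, 0, 0, 0],
  [0, 0, 0, 1], [1, 0, 0, 0])],
  [(1, [-1, 1, 1, 0, 0], [1, 0, 0, 0], [0, 1, 0, 0, 0], [1, 0, 0, 0]), (1, [-1, 0, 0, -1, -1],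
  [0, 0, 1, 0], [-1, -1, 0, 0, 0], [0, 0, 1, 0])],
  [(1, [1, 1, 0, 0], [1, 1, 0, 0, -1], [1, 0, 0, 0], [1, 0, 0, 0, 0]), (1, [0, -1, 1, 0],
  [0, 1, -1, 1, -1], [1, -1, 0, 0], [-1, 1, 0, 0, 0])],
  [(1, [-1, -1, -1, 0, -1, 0, 0, 0], [0, 0, 0, 1], [-1, 0, 0, 0, 0, 0, 0, 0], [0, 0, 0, 1])],
  [(1, [1, 0, 0, 0, 0, 0, -1, 0, 0, 0, 0, 0, 0], [0, -1, 1, 1, 0, 0, 0, 0],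
  [0, 0, 0, 0, 0, 0, -1, 0, 0, 0, 0, 0, 0], [0, 0, 0, 1, 0, 0, 0, 0]), (1,
  [-1, 0, 0, 0, 0, 0, 0, 0, -1, 0, 0, 0, 0], [-1, 0, 0, 0, 1, 0, 1, 0],
  [0, 0, 0, 0, 0, 0, 0, 0, -1, 0, 0, 0, 0], [0, 0, 0, 0, 0, 0, 1, 0]), (1,
  [-1, 0, 0, 0, -1, 0, 0, 0, 0, 0, 0, 0, 1], [0, -1, 1, 0, 0, 0, 0, 1],
  [0, 0, 0, 0, -1, 0, 0, 0, 0, 0, 0, 0, 0], [0, 0, 1, -1, 0, 0, 0, 0]), (1,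
  [0, 0, 1, 0, 0, 0, 0, 0, 0, 0, 0, 0, 0], [1, -1, 0, 0, 0, -1, 0, 1],
  [0, 0, 1, 0, 0, 0, 0, 0, 0, 0, 0, 0, 0], [0, 0, -1, 1, 0, 0, 0, 1]), (1,
  [0, 0, 0, 0, 0, 0, 0, 0, 0, 0, 0, 0, 1], [0, 1, 0, 0, -1, -1, 0, 0],
  [0, 0, 0, 0, 1, 0, 0, 0, 0, 0, 0, 0, 1], [0, 1, 0, 1, 0, 0, 0, 1]), (1,
  [1, 0, 0, 0, 0, 0, 0, 0, 0, 0, -1, 0, 0], [-1, 0, 0, 0, 1, 1, 0, 0],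
  [1, 0, 0, 0, -1, 0, 1, 0, -1, 0, 0, 0, 0], [0, 1, -1, 2, 0, 1, 0, 2])],
  [(1, [-1, 0, 0, 0, 0, 1, -1, 0], [0, 1, 0, 1, 0, 0, 0, 0, 0, 0, 0, 0, 0],
  [-1, 0, 0, 0, 0, 0, 0, 0], [0, 0, 0, 1, 0, 0, 0, 0, 0, 0, 0, 0, 0]), (1,
  [0, -1, 0, 0, -1, 0, 0, 1], [0, -1, 0, 0, 0, 0, 0, 1, 0, 0, 0, 0, 0],
  [0, -1, 0, 0, 0, 0, 0, 0], [0, 0, 0, 0, 0, 0, 0, 1, 0, 0, 0, 0, 0]), (1,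
  [0, 0, -1, 0, 1, 0, 0, -1], [0, 0, 0, 0, 0, 0, 0, 0, 0, 1, 0, -1, 0],
  [0, 0, -1, 0, 0, 0, 0, 0], [0, 0, 0, 0, 0, 0, 0, 0, 0, 1, 0, 0, 0]), (1,
  [0, 0, 0, -1, 0, -1, 1, 0], [0, 0, 0, 0, 0, 1, 0, 0, 0, 0, 0, 1, 0], [0, 0, 0, -1, 0, 0, 0, 0],
  [0, 0, 0, 0, 0, 1, 0, 0, 0, 0, 0, 0, 0]), (1, [0, 0, 0, 0, 1, 1, -2, -2],
  [0, -2, 0, 0, 0, 0, 0, 0, 0, 0, 0, 1, 0], [0, -1, 1, 0, 1, 0, 0, 0],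
  [0, 0, 0, 0, 0, -1, 0, 0, 0, 1, 0, 1, 0]), (3, [0, 0, 0, 0, 0, 0, -1, -1],
  [0, 1, 0, 0, 0, 0, 0, 0, 0, 0, 0, 0, 0], [1, 2, -2, -1, -2, 0, -1, 0],
  [0, 1, 0, -1, 0, -2, 0, 1, 0, 2, 0, 2, 0])],
  [(1, [0, -1, 0, 0, 0, 0, 0], [-1, -1, 1, 1, 1, -1, 0, 0], [0, -1, 0, 0, 0, 0, 0],
  [0, 0, 0, 0, 1, 0, 0, 0]), (1, [0, 0, 0, -1, 0, 0, 0], [1, 1, -1, -1, 0, 0, -1, 1],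
  [0, 0, 0, -1, 0, 0, 0], [0, 1, 0, 0, 1, 0, 0, 0])],
  [(1, [1, -1, -1, 0, 1, 0, 0, 0], [0, 0, 0, 0, 1, 0, 0], [1, 0, 0, 0, 0, 0, 0, 0],
  [0, 0, 0, 0, 1, 0, 0]), (1, [0, 0, 0, -1, 0, 0, 0, 1], [-1, 0, 0, 0, 0, 1, 0],
  [0, 0, 0, -1, 0, 0, 0, 0], [0, 0, 0, 0, 0, 1, 0]), (1, [0, 0, 0, 0, 0, -1, 1, 0],
  [-1, 0, 0, 0, 0, 0, 1], [0, 0, 0, 0, 0, -1, 0, 0], [0, 0, 0, 0, 0, 0, 1]), (1,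
  [0, -1, -1, 0, 0, 0, 1, 1], [1, 0, 1, 0, 0, 0, 0], [-1, -1, 0, 0, 0, 0, 0, 0],
  [1, 0, 0, 0, 0, 1, 1]), (2, [0, 0, 0, 0, 0, 0, -1, -1], [0, 0, 1, 0, 0, 0, 0],
  [-1, -1, 0, 0, 0, -1, -1, 0], [-1, 0, 1, 0, 0, -1, -1])],
  [(1, [1, 0, 0, 0], [0, 1, -1, 0, 0, 0, 0, 0], [1, 0, 0, 0], [0, 1, 0, 0, 0, 0, 0, 0]), (1,
  [0, 1, 0, 0], [1, 0, 0, 0, -1, 0, 0, 0], [0, 1, 0, 0], [1, 0, 0, 0, 0, 0, 0, 0]), (1,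
  [0, 0, 1, 0], [0, 0, 0, 1, 0, -1, -1, 1], [0, 0, 1, 0], [0, 0, 0, 1, 0, 0, 0, 0])],
  [(1, [1, 1, -1, -1, -1, -1, 0], [0, 0, 0, 1], [1, 0, 0, 0, 0, 0, 0], [0, 0, 0, 1])],
  [(1, [0, -1, 0, 1, 0, 0, 0, 0, 0, 0, 0, 0], [0, 1, 1, 0, 0, 0, 0],
  [0, 0, 0, 1, 0, 0, 0, 0, 0, 0, 0, 0], [0, 1, 0, 0, 0, 0, 0]), (1,
  [0, 1, 0, 0, 0, 1, 0, 0, 0, 0, 0, 0], [0, 0, 1, -1, 0, 0, 0],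
  [0, 0, 0, 0, 0, 1, 0, 0, 0, 0, 0, 0], [0, -1, 1, 0, 0, 0, 0]), (1,
  [0, 1, 0, 0, 0, 0, 0, 1, 0, 0, 0, 0], [1, 0, 0, 0, 1, 0, 0],
  [0, 0, 0, 0, 0, 0, 0, 1, 0, 0, 0, 0], [1, 0, 0, 0, 0, 0, 0]), (1,
  [0, -1, 0, 0, 0, 0, 0, 0, 0, 1, 0, 0], [0, 0, 0, 0, 1, -1, 0],
  [0, 0, 0, 0, 0, 0, 0, 0, 0, 1, 0, 0], [-1, 0, 0, 0, 1, 0, 0]), (1,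
  [0, 1, 0, 0, 0, 0, 0, 0, 0, 0, 0, 1], [0, 0, 0, 1, 0, -1, 1],
  [0, 1, 0, 1, 0, -1, 0, -1, 0, 1, 0, 0], [0, -1, 1, 1, 0, 0, 0])],
  [(1, [0, 1, 0, 1, 0, 2, 0, 0, 0, 0, 0, 1], [-1, 0, -2, 0, 1, 0, 0, 0, 0, 0, 1, 0],
  [0, 0, 0, 1, 0, 0, 0, 0, 0, 0, 0, 0], [0, 0, 0, 0, 1, 0, 0, 0, 0, 0, 0, 0]), (1,
  [0, 1, 0, 0, 0, 3, 0, 0, 0, 0, 0, 1], [-1, 0, 1, 0, 0, 0, 1, 0, -1, 0, 0, 0],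
  [0, 1, 0, -1, 0, 0, 0, 0, 0, 0, 0, 0], [0, 0, 1, 0, 2, 0, 0, 0, 0, 0, 0, 0]), (1,
  [0, 0, 0, 0, 0, 4, 0, -1, 0, -1, 0, 1], [1, 0, 0, 0, 0, 0, 0, 0, 0, 0, 1, 0],
  [0, -1, 0, 0, 0, 0, 0, 0, 0, 0, 0, 1], [1, 0, 1, 0, 3, 0, 0, 0, 0, 0, 0, 0]), (1,
  [0, 0, 0, 0, 0, 3, 0, -1, 0, -2, 0, 0], [0, 0, 0, 0, 0, 0, -2, 0, 1, 0, -2, 0],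
  [0, 1, 0, 0, 0, 0, 0, -1, 0, 0, 0, -1], [0, 0, 1, 0, 2, 0, 0, 0, 1, 0, 0, 0]), (1,
  [0, 0, 0, 0, 0, 1, 0, 0, 0, -2, 0, 0], [0, 0, 0, 0, 0, 0, 3, 0, 0, 0, 1, 0],
  [0, -2, 0, 1, 0, 1, 0, 3, 0, 0, 0, -1], [-1, 0, 1, 0, 0, 0, 0, 0, 2, 0, 1, 0]), (3,
  [0, 0, 0, 0, 0, 0, 0, 0, 0, 1, 0, 0], [0, 0, 0, 0, 0, 0, 1, 0, 0, 0, 0, 0],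
  [0, -3, 0, 2, 0, 2, 0, 4, 0, 1, 0, -3], [3, 0, -2, 0, 2, 0, 1, 0, -4, 0, -3, 0])]]

/-- The entry of the matrix of the coboundary in row `i` and column `j`. -/
def cobMatrixEntry (n i j : ℕ) : ℤ :=
  cobEntry n ((homBasis (n + 1)).getD i (0, 0)) ((homBasis n).getD j (0, 0))

theorem cobMatrix_apply (n : ℕ) (i : Fin (homBasis (n + 1)).length)
    (j : Fin (homBasis n).length) : cobMatrix n i j = cobMatrixEntry n i j := by
  rw [cobMatrix, Matrix.of_apply, cobMatrixEntry, List.getD_eq_getElem _ _ i.2,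
    List.getD_eq_getElem _ _ j.2]
  rfl

/-- The decomposition of the matrix of the coboundary in degree `n`. -/
def rankCert (n : ℕ) : List (ℕ × List ℤ × List ℤ × List ℤ × List ℤ) := rankTable.getD n []

/-- The `k`-th entry of the decomposition of the matrix of the coboundary in degree `n`. -/
def rankEntry (n k : ℕ) : ℕ × List ℤ × List ℤ × List ℤ × List ℤ :=
  (rankCert n).getD k (0, [], [], [], [])

/-- The number of diagonal entries in degree `n` which do not vanish in characteristic `p`. -/
def diagRank (p n : ℕ) : ℕ := (Finset.univ.filter fun k : Fin (rankCert n).length =>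
  (rankEntry n k).1 ≠ p).card

theorem rank_map_of_decomposition (K : Type u) [Field K] [DecidableEq K] {m n r : ℕ}
    (M : Matrix (Fin m) (Fin n) ℤ) (X : Matrix (Fin m) (Fin r) ℤ)
    (d : Fin r → ℤ) (Y : Matrix (Fin r) (Fin n) ℤ)
    (A : Matrix (Fin r) (Fin m) ℤ) (B : Matrix (Fin n) (Fin r) ℤ)
    (hM : M = X * Matrix.diagonal d * Y) (hA : A * X = 1) (hB : Y * B = 1) :
    (M.map (Int.cast : ℤ → K)).rank = Fintype.card {k // (d k : K) ≠ 0} := by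
  have hd : (Matrix.diagonal d).map (Int.cast : ℤ → K) = Matrix.diagonal fun k => (d k : K) :=
    Matrix.diagonal_map Int.cast_zero
  have h1 : M.map (Int.cast : ℤ → K) = X.map (Int.cast : ℤ → K) *
      Matrix.diagonal (fun k => (d k : K)) * Y.map (Int.cast : ℤ → K) := by
    rw [hM, ← hd]
    exact (Matrix.map_mul (f := Int.castRingHom K)).trans
      (congrArg (· * _) (Matrix.map_mul (f := Int.castRingHom K)))
  have h2 : Matrix.diagonal (fun k => (d k : K)) =
      A.map (Int.cast : ℤ → K) * M.map (Int.cast : ℤ → K) * B.map (Int.cast : ℤ → K) := by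
    have : Matrix.diagonal d = A * M * B := by
      rw [hM, ← Matrix.mul_assoc, ← Matrix.mul_assoc, hA, Matrix.one_mul, Matrix.mul_assoc, hB,
        Matrix.mul_one]
    rw [← hd, this]
    exact (Matrix.map_mul (f := Int.castRingHom K)).trans
      (congrArg (· * _) (Matrix.map_mul (f := Int.castRingHom K)))
  rw [← Matrix.rank_diagonal]
  refine le_antisymm ?_ ?_
  · rw [h1]
    exact (Matrix.rank_mul_le_left _ _).trans (Matrix.rank_mul_le_right _ _)
  · rw [h2]
    exact (Matrix.rank_mul_le_left _ _).trans (Matrix.rank_mul_le_right _ _)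

theorem rankCert_decomposition : ∀ n < 22, ∀ i < (homBasis (n + 1)).length,
    ∀ j < (homBasis n).length, cobMatrixEntry n i j = ((List.range (rankCert n).length).map
      fun k => (rankEntry n k).2.1.getD i 0 * (rankEntry n k).1 *
        (rankEntry n k).2.2.1.getD j 0).sum := by
  decide +kernel

theorem rankCert_dual_left : ∀ n < 22, ∀ k < (rankCert n).length, ∀ l < (rankCert n).length,
    ((List.range (homBasis (n + 1)).length).map fun i =>
      (rankEntry n k).2.2.2.1.getD i 0 * (rankEntry n l).2.1.getD i 0).sum =
      if k = l then 1 else 0 := by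
  decide +kernel

theorem rankCert_dual_right : ∀ n < 22, ∀ k < (rankCert n).length, ∀ l < (rankCert n).length,
    ((List.range (homBasis n).length).map fun j =>
      (rankEntry n k).2.2.1.getD j 0 * (rankEntry n l).2.2.2.2.getD j 0).sum =
      if k = l then 1 else 0 := by
  decide +kernel

theorem rankEntry_mem : ∀ n < 22, ∀ k < (rankCert n).length, (rankEntry n k).1 = 1 ∨
    (rankEntry n k).1 = 2 ∨ (rankEntry n k).1 = 3 := by
  decide +kernel

theorem natCast_ne_zero_iff_ne_ringChar (K : Type u) [Field K] {d : ℕ}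
    (hd : d = 1 ∨ d = 2 ∨ d = 3) : (d : K) ≠ 0 ↔ d ≠ ringChar K := by
  rw [ne_eq, ringChar.spec]
  have h1 : ringChar K ≠ 1 := CharP.ringChar_ne_one
  refine not_congr ⟨fun h => ?_, fun h => h ▸ dvd_rfl⟩
  rcases hd with rfl | rfl | rfl
  · exact absurd (Nat.dvd_one.1 h) h1
  · exact (((Nat.dvd_prime Nat.prime_two).1 h).resolve_left h1).symm
  · exact (((Nat.dvd_prime Nat.prime_three).1 h).resolve_left h1).symm

theorem sum_fin_eq_list_sum (n : ℕ) (f : ℕ → ℤ) :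
    ∑ i : Fin n, f i = ((List.range n).map f).sum :=
  Finset.sum_range f ▸ rfl

theorem cobRank_of_lt (K : Type u) [Field K] {n : ℕ} (hn : n < 22) :
    cobRank K n = diagRank (ringChar K) n := by
  classical
  rw [cobRank, rank_map_of_decomposition K (cobMatrix n)
    (Matrix.of fun i (k : Fin (rankCert n).length) => (rankEntry n k).2.1.getD i 0)
    (fun k => (rankEntry n k).1) (Matrix.of fun k j => (rankEntry n k).2.2.1.getD j 0)
    (Matrix.of fun k i => (rankEntry n k).2.2.2.1.getD i 0)
    (Matrix.of fun j k => (rankEntry n k).2.2.2.2.getD j 0), diagRank, Fintype.card_subtype]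
  · congr 1
    refine Finset.filter_congr fun k _ => ?_
    rw [Int.cast_natCast]
    exact natCast_ne_zero_iff_ne_ringChar K (rankEntry_mem n hn k k.2)
  · ext i j
    rw [cobMatrix_apply, Matrix.mul_apply, rankCert_decomposition n hn i i.2 j j.2,
      ← sum_fin_eq_list_sum]
    simp only [Matrix.mul_diagonal, Matrix.of_apply]
  · ext k l
    rw [Matrix.mul_apply, Matrix.one_apply]
    simp only [Matrix.of_apply, Fin.ext_iff]
    rw [← rankCert_dual_left n hn k k.2 l l.2, ← sum_fin_eq_list_sum]
  · ext k l
    rw [Matrix.mul_apply, Matrix.one_apply]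
    simp only [Matrix.of_apply, Fin.ext_iff]
    rw [← rankCert_dual_right n hn k k.2 l l.2, ← sum_fin_eq_list_sum]

theorem cobRank_add (K : Type u) [Field K] (n : ℕ) : cobRank K (n + 22) = cobRank K n := by
  have h (l l' m m' : List (ℕ × ℕ)) (hl : l = l') (hm : m = m') :
      ((Matrix.of fun (j : Fin l.length) (i : Fin m.length) =>
        cobEntry n (l.get j) (m.get i)).map (Int.cast : ℤ → K)).rank =
      ((Matrix.of fun (j : Fin l'.length) (i : Fin m'.length) =>
        cobEntry n (l'.get j) (m'.get i)).map (Int.cast : ℤ → K)).rank := by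
    subst hl hm
    rfl
  have hc : cobEntry (n + 22) = cobEntry n := by
    funext y x
    rw [cobEntry, cobEntry, diff_add]
  rw [cobRank, cobMatrix, hc]
  exact h _ _ _ _ (homBasis_add (n + 1)) (homBasis_add n)

theorem hhDim1_add (p : ℕ) {t : ℕ} (ht : t ≠ 0) : hhDim1 p (t + 22) = hhDim1 p t := by
  have h1 : (t + 22) / 11 % 2 = t / 11 % 2 := by lia
  have h2 : (t + 22) % 11 = t % 11 := by lia
  have h3 : (t + 22 == 0) = (t == 0) := by
    rw [beq_eq_false_iff_ne.2 ht, beq_eq_false_iff_ne.2 (by lia)]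
  simp only [hhDim1, h1, h2, h3]

theorem exists_char_eq (p : ℕ) (h1 : p ≠ 1) : ∃ q, (q = 0 ∨ q = 2 ∨ q = 3) ∧
    (∀ t, hhDim1 p t = hhDim1 q t) ∧ ∀ n < 22, diagRank p n = diagRank q n := by
  by_cases hp : p = 2 ∨ p = 3
  · exact ⟨p, .inr hp, fun _ => rfl, fun _ _ => rfl⟩
  · have h2 : (p == 2) = (0 == 2) := beq_eq_false_iff_ne.2 fun h => hp (.inl h)
    have h3 : (p == 3) = (0 == 3) := beq_eq_false_iff_ne.2 fun h => hp (.inr h)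
    refine ⟨0, .inl rfl, fun t => by simp only [hhDim1, h2, h3], fun n hn => ?_⟩
    rw [diagRank, diagRank]
    congr 1
    refine Finset.filter_congr fun k _ => ?_
    have := rankEntry_mem n hn k k.2
    lia

theorem diagRank_zero {q : ℕ} (hq : q = 0 ∨ q = 2 ∨ q = 3) :
    hhDim1 q 0 + diagRank q 0 = (homBasis 0).length := by
  have h : ∀ q ∈ [0, 2, 3], hhDim1 q 0 + diagRank q 0 = (homBasis 0).length := by decide +kernel
  exact h q (by simpa using hq)

theorem diagRank_succ {q : ℕ} (hq : q = 0 ∨ q = 2 ∨ q = 3) {n : ℕ} (hn : n < 22) :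
    hhDim1 q (n + 1) + diagRank q n + diagRank q ((n + 1) % 22) = (homBasis (n + 1)).length := by
  have h : ∀ q ∈ [0, 2, 3], ∀ n < 22, hhDim1 q (n + 1) + diagRank q n +
    diagRank q ((n + 1) % 22) = (homBasis (n + 1)).length := by decide +kernel
  exact h q (by simpa using hq) n hn

theorem hhDim1_zero_add_cobRank (K : Type u) [Field K] :
    hhDim1 (ringChar K) 0 + cobRank K 0 = (homBasis 0).length := by
  obtain ⟨q, hq, h1, h2⟩ := exists_char_eq (ringChar K) CharP.ringChar_ne_one
  rw [cobRank_of_lt K (by norm_num), h1, h2 0 (by norm_num), diagRank_zero hq]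

theorem hhDim1_succ_add_cobRank (K : Type u) [Field K] (n : ℕ) :
    hhDim1 (ringChar K) (n + 1) + cobRank K n + cobRank K (n + 1) = (homBasis (n + 1)).length := by
  refine of_periodic (fun n => hhDim1 (ringChar K) (n + 1) + cobRank K n + cobRank K (n + 1) =
    (homBasis (n + 1)).length) (fun n hn => ?_) (fun n hn => ?_) n
  · rw [show n + 22 + 1 = n + 1 + 22 by ring, hhDim1_add _ n.succ_ne_zero, cobRank_add,
      cobRank_add, homBasis_add, hn]
  · have hc : cobRank K (n + 1) = cobRank K ((n + 1) % 22) := by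
      rcases Nat.lt_or_ge (n + 1) 22 with h | h
      · rw [Nat.mod_eq_of_lt h]
      · obtain rfl : n = 21 := by lia
        exact cobRank_add K 0
    obtain ⟨q, hq, h1, h2⟩ := exists_char_eq (ringChar K) CharP.ringChar_ne_one
    have hm : (n + 1) % 22 < 22 := Nat.mod_lt _ (by norm_num)
    rw [hc, cobRank_of_lt K hn, cobRank_of_lt K hm, h1, h2 n hn, h2 _ hm, diagRank_succ hq hn]

/-- The algebra `R_1` with its basis of paths and its enveloping algebra. -/
noncomputable def pathAlg (K : Type u) [Field K] : PathAlg K (Alg K 1) (Env K 1) where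
  pth := pth K
  basis := pthBasis K
  basis_apply := pthBasis_apply K
  pth_mul := pth_mul K
  pth_eq_zero _ h := pth_eq_zero K h
  sum_pth := sum_pth K
  pure := (TensorProduct.mk K (Alg K 1) (Alg K 1)ᵐᵒᵖ).compl₂
    (MulOpposite.opLinearEquiv K).toLinearMap
  pure_one := rfl
  pure_mul a b a' b' := Algebra.TensorProduct.tmul_mul_tmul a a' (MulOpposite.op b) (MulOpposite.op b')
  lift f := TensorProduct.lift (f.compl₂ (MulOpposite.opLinearEquiv K).symm.toLinearMap)
  lift_pure _ _ _ := TensorProduct.lift.tmul _ _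
  induction p h1 h2 x := by
    induction x using TensorProduct.induction_on with
    | zero => simpa using h1 0 0
    | tmul a b => exact h1 a b.unop
    | add x y hx hy => exact h2 x y hx hy
  pure_smul a b r := (mul_assoc a r b).symm

end HochschildCohomology

/-- The additive structure of `HH^*(R_1)` (case `s = 1`) :
`dim_K HH^0 = 7`, `dim_K HH^t = 2`, `1` or `0` exactly in the listed cases. -/
theorem hochschild_dims_one (K : Type u) [Field K] (t : ℕ) :
    Module.finrank K ↥(HH K 1 t) = hhDim1 (ringChar K) t := by

  cases t with
  | zero =>
    refine Nat.add_right_cancel (m := cobRank K 0) ?_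
    rw [hhDim1_zero_add_cobRank]
    exact finrank_Ext_zero (pathAlg K)
  | succ n =>
    refine Nat.add_right_cancel (m := cobRank K n) (Nat.add_right_cancel (m := cobRank K (n + 1)) ?_)
    rw [hhDim1_succ_add_cobRank]
    exact finrank_Ext_succ (pathAlg K) n

end E6
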